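/- Fix K ∈ ℕ. There exist an integer N_K > 0 and a polynomial p_K with rational coefficients such that dim_F(W_{n,n+K}) = p_K(n) for every n ≥ N_K. -/

import Mathlib

noncomputable section

/-- The free non-unital associative algebra over `F` on countably many generators
`x_0, x_1, x_2, …`, realized as the semigroup algebra of the free semigroup on `ℕ`. -/
abbrev FreeNA (F : Type) [Field F] : Type := MonoidAlgebra F (FreeSemigroup ℕ)

/-- The monomial `x_{a_1} ⋯ x_{a_k}` attached to the list `[a_1, …, a_k]`
(and `0` for the empty list). -/
def xList (F : Type) [Field F] : List ℕ → FreeNA F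
  | [] => 0
  | a :: t => MonoidAlgebra.single (FreeSemigroup.mk a t) 1

/-- `V_m`: the space of multilinear polynomials of degree `m`, spanned by the
monomials `x_{σ(0)} x_{σ(1)} ⋯ x_{σ(m-1)}` for `σ ∈ S_m`. -/
def Vm (F : Type) [Field F] (m : ℕ) : Submodule F (FreeNA F) :=
  Submodule.span F
    (Set.range fun σ : Equiv.Perm (Fin m) =>
      xList F ((List.finRange m).map fun j => (σ j : ℕ)))

/-- A T-ideal: a two-sided ideal of `F⟨X⟩` closed under every algebra endomorphism
(an algebra endomorphism of the non-unital algebra `F⟨X⟩` being a multiplicative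
`F`-linear map). -/
def IsTIdeal (F : Type) [Field F] (I : Submodule F (FreeNA F)) : Prop :=
  (∀ a b : FreeNA F, b ∈ I → a * b ∈ I ∧ b * a ∈ I) ∧
  (∀ ψ : FreeNA F →ₗ[F] FreeNA F, (∀ x y : FreeNA F, ψ (x * y) = ψ x * ψ y) →
    ∀ a ∈ I, ψ a ∈ I)

/-- The smallest T-ideal containing `f`. -/
def TIdealGen (F : Type) [Field F] (f : FreeNA F) : Submodule F (FreeNA F) :=
  sInf {I | IsTIdeal F I ∧ f ∈ I}

/-- `W_{n,m} = V_m ∩ (x^n)^T`, where `x^n` is the `n`-th power of the variable `x_0`. -/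
def Wnm (F : Type) [Field F] (n m : ℕ) : Submodule F (FreeNA F) :=
  Vm F m ⊓ TIdealGen F (xList F (List.replicate n 0))

open Polynomial in
/-- An integer-valued quotient of polynomials is eventually polynomial. -/
theorem ratfun_nat_valued (r : ℕ → ℕ) (b c : ℚ[X]) (hc : c ≠ 0) (M0 : ℕ)
    (h : ∀ M, M0 ≤ M → (r M : ℚ) * c.eval (M : ℚ) = b.eval (M : ℚ)) :
    ∃ (p : ℚ[X]) (M1 : ℕ), ∀ M, M1 ≤ M → (r M : ℚ) = p.eval (M : ℚ) := by
  have hev : ∀ᶠ M : ℕ in Filter.atTop, c.eval (M : ℚ) ≠ 0 := by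
    have := Polynomial.eventually_atTop_not_isRoot (c.map (algebraMap ℚ ℝ))
      (by simpa [Polynomial.map_eq_zero] using hc)
    have h2 := (tendsto_natCast_atTop_atTop (R := ℝ)).eventually this
    filter_upwards [h2] with M hM h0
    apply hM
    have : (algebraMap ℚ ℝ) (c.eval (M : ℚ)) = 0 := by rw [h0]; simp
    rw [← Polynomial.eval₂_at_apply] at this
    simpa [Polynomial.eval_map, Polynomial.IsRoot] using this
  obtain ⟨D, hD, hQ⟩ := IsLocalization.integerNormalization_spec (nonZeroDivisors ℤ) (b / c)
  set Z := IsLocalization.integerNormalization (nonZeroDivisors ℤ) (b / c) with hZ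
  have hD0 : (D : ℚ) ≠ 0 := by
    have := nonZeroDivisors.ne_zero hD
    exact_mod_cast this
  have hlim := (Polynomial.div_tendsto_atTop_zero_of_degree_lt (b % c) c
      (EuclideanDomain.mod_lt b hc)).comp (tendsto_natCast_atTop_atTop (R := ℚ))
  have hlim2 : ∀ᶠ M : ℕ in Filter.atTop,
      |(D : ℚ) * ((b % c).eval (M : ℚ) / c.eval (M : ℚ))| < 1 := by
    have h3 := (hlim.const_mul (D : ℚ)).abs
    simp only [mul_zero, abs_zero] at h3
    exact h3.eventually (gt_mem_nhds one_pos)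
  refine ⟨b / c, ?_⟩
  have key : ∀ᶠ M : ℕ in Filter.atTop, (r M : ℚ) = (b / c).eval (M : ℚ) := by
    filter_upwards [hev, hlim2, Filter.eventually_ge_atTop M0] with M h1 h2 h3
    have h4 := h M h3
    have h5 : b.eval (M : ℚ) = c.eval (M : ℚ) * (b / c).eval (M : ℚ) + (b % c).eval (M : ℚ) := by
      conv_lhs => rw [← EuclideanDomain.div_add_mod b c]
      simp
    have h6 : (b % c).eval (M : ℚ) / c.eval (M : ℚ) = r M - (b / c).eval (M : ℚ) := by
      field_simp
      linarith
    have h7 : (D : ℚ) * (b / c).eval (M : ℚ) = ((Z.eval (M : ℤ) : ℤ) : ℚ) := by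
      have := congrArg (Polynomial.eval (M : ℚ)) hQ
      rw [Polynomial.eval_smul] at this
      rw [← zsmul_eq_mul]
      rw [← this, Polynomial.eval_map]
      have := Polynomial.eval₂_at_apply (p := Z) (algebraMap ℤ ℚ) (M : ℤ)
      simpa using this
    rw [h6, mul_sub, h7] at h2
    have h8 : |(D * (r M : ℤ) - Z.eval (M : ℤ) : ℤ)| < 1 := by exact_mod_cast h2
    rw [Int.abs_lt_one_iff] at h8
    have h9 : (D : ℚ) * r M - ((Z.eval (M : ℤ) : ℤ) : ℚ) = 0 := by exact_mod_cast h8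
    rw [← h7, ← mul_sub] at h9
    rcases mul_eq_zero.1 h9 with h | h
    · exact absurd h hD0
    · linarith
  exact Filter.eventually_atTop.1 key

theorem rank_idem {F I : Type*} [Field F] [Fintype I] [DecidableEq I] (E : Matrix I I F)
    (hE : E * E = E) : (E.rank : F) = E.trace := by
  have h : IsIdempotentElem (Matrix.toLin' E) := by
    unfold IsIdempotentElem
    rw [Module.End.mul_eq_comp, ← Matrix.toLin'_mul, hE]
  have h2 := (LinearMap.IsIdempotentElem.isProj_range _ h).trace
  rw [Matrix.trace_toLin'_eq] at h2
  rw [h2, Matrix.rank, Matrix.toLin'_apply']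

/-- powers of a symmetric matrix -/
theorem sym_pow_mul_eq_zero {I : Type*} [Fintype I] [DecidableEq I] (G X : Matrix I I ℚ)
    (hG : G.transpose = G) (a : ℕ) (h : G ^ a * X = 0) : G * X = 0 := by
  induction a with
  | zero => simp at h; simp [h]
  | succ a ih =>
    cases a with
    | zero => simpa using h
    | succ a =>
      apply ih
      have := (Matrix.conjTranspose_mul_self_mul_eq_zero G (G ^ a * X)).1 (by
        rw [Matrix.conjTranspose_eq_transpose_of_trivial, hG, ← h, pow_succ', pow_succ']
        simp only [Matrix.mul_assoc])
      rw [pow_succ', Matrix.mul_assoc, this]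

theorem rank_eq_of_relation {F I J : Type*} [Field F] [CharZero F] [Fintype I] [DecidableEq I]
    [Fintype J] (A : Matrix I J ℚ) (G : Matrix I I ℚ) (κ : ℚ) (hκ : κ ≠ 0)
    (hG : A * A.transpose = κ • G) (d : ℕ) (c : ℕ → ℚ) (a : ℕ) (ha : c a ≠ 0)
    (had : a < d) (hlt : ∀ i < a, c i = 0)
    (hrel : ∑ i ∈ Finset.range d, c i • G ^ i = 0) :
    ((A.map (algebraMap ℚ F)).rank : ℚ) * c a =
      - ∑ i ∈ Finset.Ico (a + 1) d, c i * (G ^ (i - a)).trace := by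
  have hGs : G.transpose = G := by
    have h1 : G = κ⁻¹ • (A * A.transpose) := by rw [hG, smul_smul, inv_mul_cancel₀ hκ, one_smul]
    rw [h1, Matrix.transpose_smul, Matrix.transpose_mul, Matrix.transpose_transpose]
  set P : Matrix I I ℚ := - ∑ i ∈ Finset.Ico (a + 1) d, ((c a)⁻¹ * c i) • G ^ (i - a - 1) with hP
  have hGP : G * P = - ∑ i ∈ Finset.Ico (a + 1) d, ((c a)⁻¹ * c i) • G ^ (i - a) := by
    rw [hP, mul_neg, Finset.mul_sum]
    congr 1
    apply Finset.sum_congr rfl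
    intro i hi
    rw [Finset.mem_Ico] at hi
    rw [mul_smul_comm, ← pow_succ']
    congr 2
    omega
  have hcomm : P * G = G * P := by
    rw [hP, mul_neg, neg_mul, Finset.mul_sum, Finset.sum_mul]
    congr 1
    apply Finset.sum_congr rfl
    intro i hi
    rw [mul_smul_comm, smul_mul_assoc, ← pow_succ', ← pow_succ]
  set E := G * P with hE
  have hz : G ^ a * (1 - E) = 0 := by
    have h1 : (c a) • (G ^ a * (1 - E)) = ∑ i ∈ Finset.range d, c i • G ^ i := by
      rw [← Finset.sum_range_add_sum_Ico _ had.le, Finset.sum_eq_zero, zero_add,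
        Finset.sum_eq_sum_Ico_succ_bot had, hGP, sub_neg_eq_add, mul_add, smul_add, mul_one,
        Finset.mul_sum, Finset.smul_sum]
      · congr 1
        apply Finset.sum_congr rfl
        intro i hi
        rw [Finset.mem_Ico] at hi
        rw [mul_smul_comm, smul_smul, mul_inv_cancel_left₀ ha, ← pow_add]
        congr 2
        omega
      · intro i hi
        rw [hlt i (Finset.mem_range.1 hi), zero_smul]
    rw [hrel] at h1
    exact (smul_eq_zero.1 h1).resolve_left ha
  have hz1 : G * (1 - E) = 0 := sym_pow_mul_eq_zero G _ hGs a hz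
  have hGE : G * E = G := by
    rw [mul_sub, mul_one, sub_eq_zero] at hz1
    exact hz1.symm
  have hEE : E * E = E := by
    calc E * E = P * G * E := by rw [hcomm]
      _ = P * (G * E) := Matrix.mul_assoc _ _ _
      _ = E := by rw [hGE, hcomm]
  have hAE : A.transpose * (1 - E) = 0 := by
    have := (Matrix.self_mul_conjTranspose_mul_eq_zero A (1 - E)).1 (by
      rw [Matrix.conjTranspose_eq_transpose_of_trivial, hG, Matrix.smul_mul, hz1, smul_zero])
    rwa [Matrix.conjTranspose_eq_transpose_of_trivial] at this
  have hAE' : A.transpose = A.transpose * E := by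
    rwa [Matrix.mul_sub, Matrix.mul_one, sub_eq_zero] at hAE
  have hEA : E = A * (κ⁻¹ • (A.transpose * P)) := by
    rw [Matrix.mul_smul, ← Matrix.mul_assoc, hG, Matrix.smul_mul, smul_smul, inv_mul_cancel₀ hκ,
      one_smul]
  set φ := algebraMap ℚ F
  have r1 : (A.map φ).rank ≤ (E.map φ).rank := by
    rw [← Matrix.rank_transpose, ← Matrix.transpose_map, hAE', Matrix.map_mul]
    exact Matrix.rank_mul_le_right _ _
  have r2 : (E.map φ).rank ≤ (A.map φ).rank := by
    rw [hEA, Matrix.map_mul]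
    exact Matrix.rank_mul_le_left _ _
  have r3 : ((A.map φ).rank : F) = φ E.trace := by
    rw [le_antisymm r1 r2, rank_idem, Matrix.trace, Matrix.trace, map_sum]
    · rfl
    · rw [← Matrix.map_mul, hEE]
  have r4 : ((A.map φ).rank : ℚ) = E.trace := by
    apply (algebraMap ℚ F).injective
    rw [← r3]; simp
  rw [r4, hGP, Matrix.trace_neg, Matrix.trace_sum, neg_mul, Finset.sum_mul]
  congr 1
  apply Finset.sum_congr rfl
  intro i hi
  rw [Matrix.trace_smul, smul_eq_mul]
  field_simp

/-- A family of functions of tuples of points of `Fin M` whose value depends only on the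
equality pattern of the tuple, polynomially in `M`. -/
def IsPP (M0 : ℕ) {ι : Type} (φ : ∀ M : ℕ, (ι → Fin M) → ℚ) : Prop :=
  ∀ (s : ℕ) (t : ι → Fin s), ∃ q : Polynomial ℚ, ∀ M, M0 ≤ M → ∀ e : Fin s ↪ Fin M,
    φ M (fun i => e (t i)) = q.eval (M : ℚ)

theorem IsPP.mul {M0 : ℕ} {ι : Type} {φ ψ : ∀ M : ℕ, (ι → Fin M) → ℚ} (h1 : IsPP M0 φ)
    (h2 : IsPP M0 ψ) : IsPP M0 (fun M f => φ M f * ψ M f) := by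
  intro s t
  obtain ⟨q1, h1⟩ := h1 s t
  obtain ⟨q2, h2⟩ := h2 s t
  exact ⟨q1 * q2, fun M hM e => by beta_reduce; rw [h1 M hM e, h2 M hM e, Polynomial.eval_mul]⟩

theorem IsPP.pull {M0 : ℕ} {ι κ : Type} {φ : ∀ M : ℕ, (ι → Fin M) → ℚ} (h1 : IsPP M0 φ)
    (g : ι → κ) : IsPP M0 (fun M (f : κ → Fin M) => φ M (fun i => f (g i))) := by
  intro s t
  obtain ⟨q1, h1⟩ := h1 s (fun i => t (g i))
  exact ⟨q1, h1⟩

theorem IsPP.sumOne {M0 : ℕ} {μ : Type} {φ : ∀ M : ℕ, (Option μ → Fin M) → ℚ}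
    (h : IsPP M0 φ) :
    IsPP M0 (fun M (f : μ → Fin M) => ∑ x : Fin M, φ M (fun o => o.elim x f)) := by
  intro s t
  choose q hq using fun y : Fin s => h s (fun o => o.elim y t)
  obtain ⟨qn, hqn⟩ := h (s + 1) (fun o => o.elim (Fin.last s) (fun i => (t i).castSucc))
  refine ⟨∑ y, q y + (Polynomial.X - Polynomial.C (s : ℚ)) * qn, ?_⟩
  intro M hM e
  classical
  beta_reduce
  rw [← Finset.sum_add_sum_compl (Finset.univ.map e), Finset.sum_map, Polynomial.eval_add,
    Polynomial.eval_finsetSum]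
  congr 1
  · apply Finset.sum_congr rfl
    intro y _
    rw [← hq y M hM e]
    congr 1
    funext o
    cases o <;> rfl
  · rw [Finset.sum_congr rfl (g := fun _ => qn.eval (M : ℚ))]
    · rw [Finset.sum_const, Finset.card_compl, Finset.card_map, nsmul_eq_mul]
      have hsM : s ≤ M := by simpa using Fintype.card_le_of_embedding e
      simp [Nat.cast_sub hsM]
    · intro x hx
      have hx' : ∀ y, e y ≠ x := by simpa using hx
      rw [← hqn M hM ⟨Fin.snoc (α := fun _ => Fin M) e x, by
        rw [Fin.snoc_injective_iff]
        refine ⟨e.injective, ?_⟩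
        rintro ⟨y, hy⟩
        exact hx' y hy⟩]
      congr 1
      funext o
      cases o <;> simp

theorem IsPP.sumAll {M0 : ℕ} (κ : Type) [Finite κ] : ∀ [Fintype κ] [DecidableEq κ] (μ : Type)
    (φ : ∀ M : ℕ, (μ ⊕ κ → Fin M) → ℚ), IsPP M0 φ →
    IsPP M0 (fun M (f : μ → Fin M) => ∑ g : κ → Fin M, φ M (Sum.elim f g)) := by
  induction κ using Finite.induction_empty_option with
  | of_equiv e ih =>
    rename_i α β
    intro _ _ μ φ hφ
    have : Fintype α := Fintype.ofEquiv _ e.symm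
    classical
    have h2 := ih μ _ (hφ.pull (Sum.map id e.symm))
    convert h2 using 3 with M f
    rw [← (Equiv.arrowCongr e (Equiv.refl (Fin M))).sum_comp]
    apply Finset.sum_congr rfl
    intro g _
    congr 1
    funext i
    rcases i with i | i <;> rfl
  | h_empty =>
    intro _ _ μ φ hφ
    have h2 := hφ.pull (Sum.elim id PEmpty.elim)
    convert h2 using 3 with M f
    rw [Fintype.sum_unique]
    congr 1
    funext i
    rcases i with i | i
    · rfl
    · exact i.elim
  | h_option ih =>
    rename_i κ _
    intro _ _ μ φ hφ
    classical
    have h1 := hφ.pull (κ := Option (μ ⊕ κ))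
      (Sum.elim (fun i => some (Sum.inl i)) (fun o => o.elim none (fun k => some (Sum.inr k))))
    have h2 := ih μ _ h1.sumOne
    convert h2 using 3 with M f
    rw [← (Equiv.piOptionEquivProd (β := fun _ : Option κ => Fin M)).symm.sum_comp, Fintype.sum_prod_type, Finset.sum_comm]
    apply Finset.sum_congr rfl
    intro g _
    apply Finset.sum_congr rfl
    intro x _
    congr 1
    funext i
    rcases i with i | (_ | k) <;> rfl

/-- the tuple pattern version of a family of matrices -/
def PPMat (M0 : ℕ) {ι : Type} (G : ∀ M : ℕ, Matrix (ι → Fin M) (ι → Fin M) ℚ) : Prop :=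
  IsPP M0 (fun M (f : ι ⊕ ι → Fin M) => G M (fun i => f (Sum.inl i)) (fun i => f (Sum.inr i)))

theorem PPMat.mul {M0 : ℕ} {ι : Type} [Fintype ι] [DecidableEq ι]
    {G H : ∀ M : ℕ, Matrix (ι → Fin M) (ι → Fin M) ℚ}
    (hG : PPMat M0 G) (hH : PPMat M0 H) : PPMat M0 (fun M => G M * H M) := by
  have h1 := hG.pull (κ := (ι ⊕ ι) ⊕ ι) (Sum.elim (fun i => Sum.inl (Sum.inl i)) Sum.inr)
  have h2 := hH.pull (κ := (ι ⊕ ι) ⊕ ι) (Sum.elim Sum.inr (fun i => Sum.inl (Sum.inr i)))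
  exact IsPP.sumAll ι (ι ⊕ ι) _ (h1.mul h2)

theorem PPMat.one {M0 : ℕ} {ι : Type} [Fintype ι] [DecidableEq ι] :
    PPMat M0 (fun M => (1 : Matrix (ι → Fin M) (ι → Fin M) ℚ)) := by
  intro s t
  refine ⟨if (fun i => t (Sum.inl i)) = (fun i => t (Sum.inr i)) then 1 else 0, ?_⟩
  intro M hM e
  change (1 : Matrix (ι → Fin M) (ι → Fin M) ℚ) _ _ = _
  rw [Matrix.one_apply]
  by_cases h : (fun i => t (Sum.inl i)) = (fun i => t (Sum.inr i))
  · rw [if_pos h, if_pos, Polynomial.eval_one]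
    funext i
    exact congrArg e (congrFun h i)
  · rw [if_neg h, if_neg, Polynomial.eval_zero]
    intro h'
    apply h
    funext i
    exact e.injective (congrFun h' i)

theorem PPMat.pow {M0 : ℕ} {ι : Type} [Fintype ι] [DecidableEq ι]
    {G : ∀ M : ℕ, Matrix (ι → Fin M) (ι → Fin M) ℚ}
    (hG : PPMat M0 G) (k : ℕ) : PPMat M0 (fun M => G M ^ k) := by
  induction k with
  | zero => simpa using PPMat.one
  | succ k ih => simpa [pow_succ] using ih.mul hG

theorem PPMat.trace {M0 : ℕ} {ι : Type} [Fintype ι] [DecidableEq ι]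
    {G : ∀ M : ℕ, Matrix (ι → Fin M) (ι → Fin M) ℚ}
    (hG : PPMat M0 G) : ∃ q : Polynomial ℚ, ∀ M, M0 ≤ M → (G M).trace = q.eval (M : ℚ) := by
  have h1 := hG.pull (κ := Empty ⊕ ι) (Sum.elim Sum.inr Sum.inr)
  obtain ⟨q, hq⟩ := IsPP.sumAll ι Empty _ h1 0 Empty.elim
  exact ⟨q, fun M hM => (hq M hM ⟨Fin.elim0, fun x => x.elim0⟩)⟩

theorem factor_pattern {ι : Type} [Fintype ι] {M : ℕ} (f : ι → Fin M) :
    ∃ (s : Fin (Fintype.card ι + 1)) (t : ι → Fin s) (e : Fin s ↪ Fin M), ∀ i, f i = e (t i) := by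
  classical
  let R := {x // x ∈ Finset.univ.image f}
  have hc : Fintype.card R = (Finset.univ.image f).card := by
    simp [R, Fintype.card_subtype]
  have hle : Fintype.card R < Fintype.card ι + 1 := by
    rw [hc]
    exact Nat.lt_succ_of_le Finset.card_image_le
  refine ⟨⟨Fintype.card R, hle⟩, fun i => Fintype.equivFin R ⟨f i, by simp⟩,
    ⟨fun x => ((Fintype.equivFin R).symm x).1, ?_⟩, ?_⟩
  · intro x y h
    exact (Fintype.equivFin R).symm.injective (Subtype.ext h)
  · intro i
    change f i = ((Fintype.equivFin R).symm (Fintype.equivFin R ⟨f i, _⟩)).1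
    rw [Equiv.symm_apply_apply]

open Polynomial in
/-- Polynomial relation between the powers of `G`. -/
theorem PPMat.relation {M0 : ℕ} {ι : Type} [Fintype ι] [DecidableEq ι]
    {G : ∀ M : ℕ, Matrix (ι → Fin M) (ι → Fin M) ℚ} (hG : PPMat M0 G) :
    ∃ (d : ℕ) (c : ℕ → ℚ[X]) (a : ℕ), c a ≠ 0 ∧ a < d ∧ (∀ i < a, c i = 0) ∧
      ∀ M, M0 ≤ M → ∑ i ∈ Finset.range d, (c i).eval (M : ℚ) • G M ^ i = 0 := by
  let T := Σ s : Fin (Fintype.card (ι ⊕ ι) + 1), (ι ⊕ ι → Fin s)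
  choose q hq using fun (k : ℕ) (x : T) => hG.pow k x.1 x.2
  let v : Fin (Fintype.card T + 1) → (T → ℚ[X]) := fun k x => q k x
  have hv : ¬ LinearIndependent ℚ[X] v := by
    intro h
    have := h.fintype_card_le_finrank
    simp at this
  rw [Fintype.not_linearIndependent_iff] at hv
  obtain ⟨g, hg, i0, hi0⟩ := hv
  let c : ℕ → ℚ[X] := fun i => if h : i < Fintype.card T + 1 then g ⟨i, h⟩ else 0
  have hex : ∃ i, c i ≠ 0 := ⟨i0, by simp only [c]; rw [dif_pos i0.2]; exact hi0⟩
  classical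
  refine ⟨Fintype.card T + 1, c, Nat.find hex, Nat.find_spec hex, ?_, ?_, ?_⟩
  · by_contra h
    exact Nat.find_spec hex (by simp only [c]; rw [dif_neg h])
  · intro i hi
    simpa using Nat.find_min hex hi
  · intro M hM
    ext f h
    obtain ⟨s, t, e, hst⟩ := factor_pattern (Sum.elim f h)
    rw [Finset.sum_range, Matrix.sum_apply, Matrix.zero_apply]
    have h1 := congrArg (Polynomial.eval (M : ℚ)) (congrFun hg ⟨s, t⟩)
    simp only [Finset.sum_apply, Pi.smul_apply, Pi.zero_apply, Polynomial.eval_finsetSum,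
      Polynomial.eval_zero, smul_eq_mul, Polynomial.eval_mul] at h1
    rw [← h1]
    apply Finset.sum_congr rfl
    intro i _
    rw [Matrix.smul_apply, smul_eq_mul, ← hq i ⟨s, t⟩ M hM e]
    simp only [c, i.2, dif_pos, ← hst]
    rfl

open Polynomial in
theorem rank_eventually_poly {ι : Type} [Fintype ι] [DecidableEq ι] (M0 : ℕ)
    (G : ∀ M : ℕ, Matrix (ι → Fin M) (ι → Fin M) ℚ) (hG : PPMat M0 G)
    (Ω : ℕ → Type) [∀ M, Fintype (Ω M)] (A : ∀ M, Matrix (ι → Fin M) (Ω M) ℚ) (κ : ℕ → ℚ)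
    (hA : ∀ M, M0 ≤ M → κ M ≠ 0 ∧ A M * (A M).transpose = κ M • G M)
    (F : Type) [Field F] [CharZero F] :
    ∃ (p : ℚ[X]) (M1 : ℕ), ∀ M, M1 ≤ M →
      (((A M).map (algebraMap ℚ F)).rank : ℚ) = p.eval (M : ℚ) := by
  obtain ⟨d, c, a, ha, had, hlt, hrel⟩ := hG.relation
  choose tr htr using fun k => (hG.pow k).trace
  obtain ⟨M1, hM1⟩ : ∃ M1 : ℕ, ∀ M : ℕ, M1 ≤ M → (c a).eval (M : ℚ) ≠ 0 := by
    have := Polynomial.eventually_atTop_not_isRoot (c a) ha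
    exact Filter.eventually_atTop.1 ((tendsto_natCast_atTop_atTop (R := ℚ)).eventually this)
  refine ratfun_nat_valued _ (- ∑ i ∈ Finset.Ico (a + 1) d, c i * tr (i - a)) (c a) ha
    (max M0 M1) ?_
  intro M hM
  have hM0 := le_of_max_le_left hM
  have := rank_eq_of_relation (F := F) (A M) (G M) (κ M) (hA M hM0).1 (hA M hM0).2 d
    (fun i => (c i).eval (M : ℚ)) a (hM1 M (le_of_max_le_right hM)) had
    (fun i hi => by simp [hlt i hi]) (hrel M hM0)
  rw [this, Polynomial.eval_neg, Polynomial.eval_finsetSum]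
  congr 1
  apply Finset.sum_congr rfl
  intro i _
  rw [Polynomial.eval_mul, htr _ M hM0]

/-- Transitive permutations (cycles of full length). -/
def FC {α : Type} (c : Equiv.Perm α) : Prop := ∀ x y, c.SameCycle x y

/-- Number of full cycles satisfying prescribed arrows. -/
noncomputable def NC (α : Type) (L : List (α × α)) : ℕ :=
  Nat.card {c : Equiv.Perm α // FC c ∧ ∀ p ∈ L, c p.1 = p.2}

theorem sameCycle_of_rel {α : Type} (c : Equiv.Perm α) (R : α → α → Prop) (hR : Equivalence R)
    (h : ∀ x, R x (c x)) {x y : α} (hxy : c.SameCycle x y) : R x y := by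
  obtain ⟨k, rfl⟩ := hxy
  induction k using Int.induction_on with
  | zero => simpa using hR.refl x
  | succ k ih =>
    refine hR.trans ih ?_
    rw [add_comm, zpow_add, zpow_one, Equiv.Perm.mul_apply]
    exact h _
  | pred k ih =>
    refine hR.trans ih (hR.symm ?_)
    have := h ((c ^ (-(k : ℤ) - 1)) x)
    rwa [← Equiv.Perm.mul_apply, ← zpow_one_add, add_sub_cancel] at this

theorem FC_iff {α : Type} [Fintype α] [DecidableEq α] (h2 : 2 ≤ Fintype.card α)
    (c : Equiv.Perm α) : FC c ↔ c.cycleType = {Fintype.card α} := by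
  have : Nontrivial α := Fintype.one_lt_card_iff_nontrivial.1 (by omega)
  constructor
  · intro h
    have hne : ∀ x, c x ≠ x := by
      intro x hx
      obtain ⟨y, hy⟩ := exists_ne x
      obtain ⟨k, hk⟩ := h x y
      apply hy
      rw [← hk]
      exact Equiv.Perm.zpow_apply_eq_self_of_apply_eq_self hx k
    obtain ⟨x⟩ : Nonempty α := inferInstance
    have hc : c.IsCycle := ⟨x, hne x, fun y _ => h x y⟩
    rw [hc.cycleType]
    congr 1
    rw [← Finset.card_univ]
    congr 1
    ext y
    simp [hne y]
  · intro h x y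
    have hc : c.IsCycle := by
      rw [← Equiv.Perm.card_cycleType_eq_one, h]; simp
    have hs : c.support.card = Fintype.card α := by
      rw [← Equiv.Perm.sum_cycleType, h]; simp
    have hs' : c.support = Finset.univ := by
      rwa [← Finset.card_eq_iff_eq_univ]
    apply hc.sameCycle
    · rw [← Equiv.Perm.mem_support, hs']; simp
    · rw [← Equiv.Perm.mem_support, hs']; simp

theorem card_FC {α : Type} [Fintype α] [DecidableEq α] (h2 : 2 ≤ Fintype.card α) :
    Nat.card {c : Equiv.Perm α // FC c} = (Fintype.card α - 1).factorial := by
  have := Equiv.Perm.card_of_cycleType_singleton (α := α) h2 le_rfl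
  rw [Nat.choose_self, mul_one] at this
  rw [← this, Nat.card_congr (Equiv.subtypeEquivRight (FC_iff h2)), Nat.card_eq_fintype_card,
    Fintype.card_subtype]

section contraction
variable {α : Type} [DecidableEq α] {a b : α}

/-- insert `b` right after `a` -/
def TT (a b : α) (c : Equiv.Perm {x // x ≠ b}) : Equiv.Perm α :=
  Equiv.Perm.ofSubtype c * Equiv.swap a b

theorem TT_a (c : Equiv.Perm {x // x ≠ b}) : TT a b c a = b := by
  simp [TT, Equiv.Perm.ofSubtype_apply_of_not_mem]

theorem TT_b (hab : a ≠ b) (c : Equiv.Perm {x // x ≠ b}) : TT a b c b = c ⟨a, hab⟩ := by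
  simp [TT, Equiv.Perm.ofSubtype_apply_of_mem, hab]

theorem TT_x (c : Equiv.Perm {x // x ≠ b}) {x : α} (hx : x ≠ b) (hxa : x ≠ a) :
    TT a b c x = c ⟨x, hx⟩ := by
  simp [TT, Equiv.swap_apply_of_ne_of_ne hxa hx, Equiv.Perm.ofSubtype_apply_of_mem, hx]

theorem TT_inj : Function.Injective (TT a b) := by
  intro c d h
  exact Equiv.Perm.ofSubtype_injective (mul_right_cancel h)

theorem TT_surj (c : Equiv.Perm α) (h : c a = b) : ∃ d, TT a b d = c := by
  have hfix : (c * Equiv.swap a b) b = b := by simp [h]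
  refine ⟨Equiv.Perm.subtypePerm (c * Equiv.swap a b) (fun x => ?_), ?_⟩
  · rw [ne_eq, ne_eq, not_iff_not]
    constructor
    · intro h; exact (c * Equiv.swap a b).injective (h.trans hfix.symm)
    · rintro rfl; exact hfix
  · unfold TT
    rw [Equiv.Perm.ofSubtype_subtypePerm]
    · rw [mul_assoc, Equiv.swap_mul_self, mul_one]
    · rintro x hx rfl
      exact hx hfix

theorem TT_FC (hab : a ≠ b) (c : Equiv.Perm {x // x ≠ b}) : FC (TT a b c) ↔ FC c := by
  constructor
  · intro h
    let π : α → {x // x ≠ b} := fun x => if hx : x = b then ⟨a, hab⟩ else ⟨x, hx⟩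
    have hπ : ∀ x : {x // x ≠ b}, π x = x := fun x => by simp [π, x.2]
    have key : ∀ x, c.SameCycle (π x) (π (TT a b c x)) := by
      intro x
      by_cases hxb : x = b
      · subst hxb
        rw [TT_b hab, hπ]
        simp only [π, dif_pos]
        exact (Equiv.Perm.sameCycle_apply_right).2 (Equiv.Perm.SameCycle.refl _ _)
      by_cases hxa : x = a
      · subst hxa
        rw [TT_a]
        simp only [π, dif_pos, dif_neg hxb]
        exact Equiv.Perm.SameCycle.refl _ _
      rw [TT_x c hxb hxa, hπ]
      simp only [π, dif_neg hxb]
      exact (Equiv.Perm.sameCycle_apply_right).2 (Equiv.Perm.SameCycle.refl _ _)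
    intro x y
    have := sameCycle_of_rel (TT a b c) (fun x y => c.SameCycle (π x) (π y))
      ⟨fun _ => Equiv.Perm.SameCycle.refl _ _, fun h => h.symm, fun h h' => h.trans h'⟩ key (h x y)
    simpa only [hπ] using this
  · intro h
    have key : ∀ x : {x // x ≠ b}, (TT a b c).SameCycle x (c x) := by
      rintro ⟨x, hxb⟩
      by_cases hxa : x = a
      · subst hxa
        rw [← TT_b hxb]
        refine Equiv.Perm.sameCycle_apply_right.2 ?_
        conv => arg 3; rw [← TT_a (a := x) (b := b) c]
        exact Equiv.Perm.sameCycle_apply_right.2 (Equiv.Perm.SameCycle.refl _ _)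
      · rw [← TT_x c hxb hxa]
        exact Equiv.Perm.sameCycle_apply_right.2 (Equiv.Perm.SameCycle.refl _ _)
    have h1 : ∀ x y : {x // x ≠ b}, (TT a b c).SameCycle x y := fun x y =>
      sameCycle_of_rel c (fun x y => (TT a b c).SameCycle x y)
        ⟨fun _ => Equiv.Perm.SameCycle.refl _ _, fun h => h.symm, fun h h' => h.trans h'⟩ key (h x y)
    have h2 : ∀ x, (TT a b c).SameCycle a x := by
      intro x
      by_cases hxb : x = b
      · subst hxb
        conv => arg 3; rw [← TT_a (a := a) (b := x) c]
        exact Equiv.Perm.sameCycle_apply_right.2 (Equiv.Perm.SameCycle.refl _ _)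
      · exact h1 ⟨a, hab⟩ ⟨x, hxb⟩
    exact fun x y => (h2 x).symm.trans (h2 y)

theorem NC_congr_TT (hab : a ≠ b) (L : List (α × α)) (L' : List ({x // x ≠ b} × {x // x ≠ b}))
    (hL : ∀ c, (∀ p ∈ L, TT a b c p.1 = p.2) ↔ ∀ p ∈ L', c p.1 = p.2) :
    NC α ((a, b) :: L) = NC _ L' := by
  symm
  unfold NC
  refine Nat.card_congr (Equiv.ofBijective (fun c => ⟨TT a b c.1, (TT_FC hab _).2 c.2.1, ?_⟩) ⟨?_, ?_⟩)
  · intro p hp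
    rcases List.mem_cons.1 hp with rfl | hp
    · exact TT_a _
    · exact (hL _).2 c.2.2 p hp
  · intro c d h
    exact Subtype.ext (TT_inj (congrArg Subtype.val h))
  · rintro ⟨c, hc, hc2⟩
    obtain ⟨d, rfl⟩ := TT_surj c (hc2 (a, b) (by simp))
    exact ⟨⟨d, (TT_FC hab _).1 hc, (hL d).1 (fun p hp => hc2 p (List.mem_cons_of_mem _ hp))⟩, rfl⟩

end contraction

theorem NC_eq_zero {α : Type} {L : List (α × α)}
    (h : ∀ c : Equiv.Perm α, FC c → (∀ p ∈ L, c p.1 = p.2) → False) : NC α L = 0 := by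
  unfold NC
  have : IsEmpty {c : Equiv.Perm α // FC c ∧ ∀ p ∈ L, c p.1 = p.2} :=
    ⟨fun c => h c.1 c.2.1 c.2.2⟩
  exact Nat.card_of_isEmpty

theorem NC_count (r : ℕ) : ∀ (S : Type) [DecidableEq S] (L : List (S × S)), L.length = r →
    ∃ o : Option ℕ, (∀ j ∈ o, j ≤ L.length ∧ (L.Nodup → j = L.length)) ∧
      ∀ (α : Type) [Fintype α] [DecidableEq α] (e : S ↪ α), L.length + 2 ≤ Fintype.card α →
        NC α (L.map (Prod.map e e)) = o.elim 0 (fun j => (Fintype.card α - 1 - j).factorial) := by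
  induction r using Nat.strong_induction_on with
  | _ r ih =>
  intro S _ L hr
  rcases L with _ | ⟨⟨a, b⟩, L1⟩
  · refine ⟨some 0, by simp, ?_⟩
    intro α _ _ e hα
    simp only [List.length_nil, zero_add] at hα
    simp only [NC, List.map_nil, List.not_mem_nil, false_imp_iff, implies_true, and_true,
      Option.elim, Nat.sub_zero]
    exact card_FC hα
  by_cases hab : a = b
  · subst hab
    refine ⟨none, by simp, ?_⟩
    intro α _ _ e hα
    apply NC_eq_zero
    intro c hc hL
    have h1 : c (e a) = e a := hL (e a, e a) (by simp)
    have : Nontrivial α := Fintype.one_lt_card_iff_nontrivial.1 (by omega)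
    obtain ⟨y, hy⟩ := exists_ne (e a)
    obtain ⟨k, hk⟩ := hc (e a) y
    apply hy
    rw [← hk]
    exact Equiv.Perm.zpow_apply_eq_self_of_apply_eq_self h1 k
  by_cases hbad : ∃ p ∈ L1, (p.1 = a ∧ p.2 ≠ b) ∨ (p.2 = b ∧ p.1 ≠ a)
  · refine ⟨none, by simp, ?_⟩
    intro α _ _ e hα
    apply NC_eq_zero
    intro c hc hL
    have h1 : c (e a) = e b := hL (e a, e b) (by simp)
    obtain ⟨⟨x, y⟩, hp, hp2⟩ := hbad
    have h2 : c (e x) = e y := hL (e x, e y) (by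
      simp only [List.map_cons, List.mem_cons]
      right
      exact List.mem_map.2 ⟨(x, y), hp, rfl⟩)
    rcases hp2 with ⟨h3, h4⟩ | ⟨h3, h4⟩
    · simp only at h3 h4
      subst h3
      exact h4 (e.injective (h2.symm.trans h1))
    · simp only at h3 h4
      subst h3
      exact h4 (e.injective (c.injective (h2.trans h1.symm)))
  have hgood : ∀ p ∈ L1, p ≠ (a, b) → p.1 ≠ a ∧ p.2 ≠ b := by
    rintro ⟨x, y⟩ hp hne
    push Not at hbad
    have := hbad _ hp
    simp only at this ⊢
    refine ⟨fun h => hne ?_, fun h => hne ?_⟩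
    · rw [h, this.1 h]
    · rw [h, this.2 h]
  let g : S → {x // x ≠ b} := fun x => if hx : x = b then ⟨a, hab⟩ else ⟨x, hx⟩
  let L2 := L1.filter (fun p => p ≠ (a, b))
  let L' := L2.map (fun p => (g p.1, g p.2))
  have hlen2 : L2.length ≤ L1.length := List.length_filter_le _ _
  have hlen' : L'.length = L2.length := by simp [L']
  simp only [List.length_cons] at hr
  obtain ⟨o', ho', hcount⟩ := ih L'.length (by omega) {x // x ≠ b} L' rfl
  refine ⟨o'.map (· + 1), ?_, ?_⟩
  · intro j hj
    simp only [Option.mem_def, Option.map_eq_some_iff] at hj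
    obtain ⟨j', hj', rfl⟩ := hj
    obtain ⟨h1, h2⟩ := ho' j' hj'
    simp only [List.length_cons]
    refine ⟨by omega, ?_⟩
    intro hnd
    rw [List.nodup_cons] at hnd
    have hL2 : L2 = L1 := by
      apply List.filter_eq_self.2
      intro p hp
      simp only [ne_eq, decide_not, Bool.not_eq_true', decide_eq_false_iff_not]
      rintro rfl
      exact hnd.1 hp
    have hL'nd : L'.Nodup := by
      apply List.Nodup.map_on
      · rintro ⟨x, y⟩ hp ⟨x', y'⟩ hp' h
        rw [hL2] at hp hp'
        have g1 := hgood _ hp (by rintro h; exact hnd.1 (h ▸ hp))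
        have g2 := hgood _ hp' (by rintro h; exact hnd.1 (h ▸ hp'))
        simp only at g1 g2
        simp only [Prod.mk.injEq, g, g1.2, g2.2, dif_neg, not_false_eq_true, Subtype.mk.injEq] at h ⊢
        refine ⟨?_, h.2⟩
        have h1 := h.1
        split_ifs at h1 with h3 h4 h4
        · rw [h3, h4]
        · exact absurd (congrArg Subtype.val h1).symm g2.1
        · exact absurd (congrArg Subtype.val h1) g1.1
        · exact congrArg Subtype.val h1
      · rw [hL2]; exact hnd.2
    rw [h2 hL'nd, hlen', hL2]
  · intro α _ _ e hα
    simp only [List.length_cons] at hα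
    let e' : {x // x ≠ b} ↪ {x // x ≠ e b} :=
      ⟨fun x => ⟨e x, fun h => x.2 (e.injective h)⟩, fun x y h =>
        Subtype.ext (e.injective (congrArg Subtype.val h))⟩
    have hcard : Fintype.card {x // x ≠ e b} = Fintype.card α - 1 := by
      rw [Fintype.card_subtype_compl, Fintype.card_subtype_eq]
    have hc := hcount {x // x ≠ e b} e' (by omega)
    have heab : e a ≠ e b := fun h => hab (e.injective h)
    have := NC_congr_TT heab (L1.map (Prod.map e e)) (L'.map (Prod.map e' e')) (by
      intro c
      have hk : ∀ p ∈ L1, p ≠ (a, b) →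
          (TT (e a) (e b) c (e p.1) = e p.2 ↔ c (e' (g p.1)) = e' (g p.2)) := by
        rintro ⟨x, y⟩ hp hne
        have g1 := hgood _ hp hne
        simp only at g1 ⊢
        have hy : (e' (g y)).1 = e y := by
          have hg : g y = ⟨y, g1.2⟩ := dif_neg g1.2
          rw [hg]; rfl
        rw [Subtype.ext_iff, hy]
        by_cases hxb : x = b
        · subst hxb
          rw [TT_b heab]
          have : e' (g x) = ⟨e a, heab⟩ := by
            have hg : g x = ⟨a, hab⟩ := dif_pos rfl
            rw [hg]; rfl
          rw [this]
        · rw [TT_x c (fun h => hxb (e.injective h)) (fun h => g1.1 (e.injective h))]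
          have : e' (g x) = ⟨e x, fun h => hxb (e.injective h)⟩ := by
            have hg : g x = ⟨x, hxb⟩ := dif_neg hxb
            rw [hg]; rfl
          rw [this]
      constructor
      · intro h p' hp'
        obtain ⟨p1, hp1, rfl⟩ := List.mem_map.1 hp'
        obtain ⟨p, hp, rfl⟩ := List.mem_map.1 hp1
        have hp := List.mem_filter.1 hp
        have hne : p ≠ (a, b) := by simpa using hp.2
        exact (hk p hp.1 hne).1 (h (e p.1, e p.2) (List.mem_map.2 ⟨p, hp.1, rfl⟩))
      · intro h p' hp'
        obtain ⟨p, hp, rfl⟩ := List.mem_map.1 hp'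
        by_cases hne : p = (a, b)
        · subst hne
          exact TT_a _
        · exact (hk p hp hne).2 (h (e' (g p.1), e' (g p.2)) (List.mem_map.2 ⟨(g p.1, g p.2),
            List.mem_map.2 ⟨p, List.mem_filter.2 ⟨hp, by simpa using hne⟩, rfl⟩, rfl⟩)))
    rw [List.map_cons, Prod.map_apply, this, hc]
    cases o' with
    | none => rfl
    | some j =>
      simp only [Option.elim, Option.map_some]
      congr 1
      omega

open Polynomial

/-- Extension of a permutation of letters fixing the marker `0`. -/
def hatP {m : ℕ} (σ : Equiv.Perm (Fin m)) : Equiv.Perm (Fin (m + 1)) :=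
  Equiv.Perm.decomposeFin.symm (0, σ)

theorem hatP_zero {m : ℕ} (σ : Equiv.Perm (Fin m)) : hatP σ 0 = 0 := by
  simp [hatP]

theorem hatP_succ {m : ℕ} (σ : Equiv.Perm (Fin m)) (i : Fin m) : hatP σ i.succ = (σ i).succ := by
  simp [hatP]

/-- The full cycle attached to a permutation (word). -/
def cyc {m : ℕ} (σ : Equiv.Perm (Fin m)) : Equiv.Perm (Fin (m + 1)) :=
  hatP σ * finRotate (m + 1) * (hatP σ)⁻¹

theorem cyc_hat {m : ℕ} (σ : Equiv.Perm (Fin m)) (i : Fin (m + 1)) :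
    cyc σ (hatP σ i) = hatP σ (i + 1) := by
  simp [cyc]

theorem cyc_FC {m : ℕ} (σ : Equiv.Perm (Fin m)) : FC (cyc σ) := by
  intro x y
  rw [cyc, Equiv.Perm.sameCycle_conj]
  rcases m with _ | m
  · have : ∀ a b : Fin 1, a = b := by decide
    rw [this ((hatP σ)⁻¹ x) ((hatP σ)⁻¹ y)]
  · apply (isCycle_finRotate (n := m)).sameCycle <;>
    · rw [← Equiv.Perm.mem_support, support_finRotate]; simp

theorem cyc_injective {m : ℕ} : Function.Injective (cyc (m := m)) := by
  intro σ τ h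
  have key : ∀ i : Fin (m + 1), hatP σ i = hatP τ i := by
    intro i
    induction i using Fin.induction with
    | zero => simp [hatP_zero]
    | succ i ih =>
      have h1 := cyc_hat σ i.castSucc
      have h2 := cyc_hat τ i.castSucc
      rw [Fin.coeSucc_eq_succ] at h1 h2
      rw [← h1, ← h2, ih, h]
  ext i
  have := key i.succ
  rw [hatP_succ, hatP_succ] at this
  exact congrArg Fin.val (Fin.succ_injective _ this)

theorem card_compat {m : ℕ} (hm : 1 ≤ m) (L : List (Fin (m+1) × Fin (m+1))) :
    Nat.card {σ : Equiv.Perm (Fin m) // ∀ p ∈ L, cyc σ p.1 = p.2} = NC (Fin (m+1)) L := by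
  have hbij : Function.Bijective
      (fun σ : Equiv.Perm (Fin m) => (⟨cyc σ, cyc_FC σ⟩ : {c : Equiv.Perm (Fin (m+1)) // FC c})) := by
    have : Finite {c : Equiv.Perm (Fin (m+1)) // FC c} := inferInstance
    rw [Nat.bijective_iff_injective_and_card]
    refine ⟨fun a b h => cyc_injective (congrArg Subtype.val h), ?_⟩
    rw [card_FC (by simp; omega)]
    simp [Nat.card_eq_fintype_card, Fintype.card_perm]
  unfold NC
  refine Nat.card_eq_of_bijective (fun σ => ⟨cyc σ.1, cyc_FC σ.1, σ.2⟩) ⟨?_, ?_⟩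
  · intro a b h
    exact Subtype.ext (cyc_injective (congrArg Subtype.val h))
  · rintro ⟨c, hc, hL⟩
    obtain ⟨σ, hσ⟩ := hbij.2 ⟨c, hc⟩
    have : cyc σ = c := congrArg Subtype.val hσ
    subst this
    exact ⟨⟨σ, hL⟩, rfl⟩

/-- The list of arrows attached to an index. -/
def arrows {K : ℕ} {α : Type} (f : Fin K ⊕ Fin K → α) : List (α × α) :=
  List.ofFn fun i => (f (Sum.inl i), f (Sum.inr i))

theorem arrows_comp {K : ℕ} {α β : Type} (e : α → β) (f : Fin K ⊕ Fin K → α) :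
    arrows (fun i => e (f i)) = (arrows f).map (Prod.map e e) := by
  simp [arrows, List.map_ofFn]; rfl

theorem arrows_length {K : ℕ} {α : Type} (f : Fin K ⊕ Fin K → α) : (arrows f).length = K := by
  simp [arrows]

open Classical in
/-- The incidence matrix between arrow systems and words. -/
noncomputable def Amat (K : ℕ) :
    ∀ M : ℕ, Matrix (Fin K ⊕ Fin K → Fin M) (Equiv.Perm (Fin (M - 1))) ℚ
  | 0 => 0
  | _ + 1 => fun f σ => if (arrows f).Nodup ∧ ∀ p ∈ arrows f, cyc σ p.1 = p.2 then 1 else 0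

theorem ite_mul_ite_aux (P Q : Prop) [Decidable P] [Decidable Q] [Decidable (P ∧ Q)] :
    ((if P then (1:ℚ) else 0) * (if Q then 1 else 0)) = if P ∧ Q then 1 else 0 := by
  by_cases h1 : P <;> by_cases h2 : Q <;> simp [h1, h2]

open Classical in
theorem Amat_gram (K m : ℕ) (hm : 1 ≤ m) (f g : Fin K ⊕ Fin K → Fin (m+1)) :
    (Amat K (m+1) * (Amat K (m+1)).transpose) f g =
      if (arrows f).Nodup ∧ (arrows g).Nodup then
        (NC (Fin (m+1)) (arrows f ++ arrows g) : ℚ) else 0 := by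
  rw [← card_compat hm]
  rw [Matrix.mul_apply]
  change (∑ σ : Equiv.Perm (Fin m),
    (if (arrows f).Nodup ∧ ∀ p ∈ arrows f, cyc σ p.1 = p.2 then (1:ℚ) else 0) *
    (if (arrows g).Nodup ∧ ∀ p ∈ arrows g, cyc σ p.1 = p.2 then (1:ℚ) else 0)) = _
  split_ifs with h
  · rw [Nat.card_eq_fintype_card, Fintype.card_subtype, Finset.card_filter]
    push_cast
    refine Finset.sum_congr rfl fun σ _ => ?_
    simp only [h.1, h.2, true_and, List.mem_append, or_imp, forall_and]
    exact ite_mul_ite_aux _ _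
  · refine Finset.sum_eq_zero fun σ _ => ?_
    by_cases h1 : (arrows f).Nodup
    · have h2 : ¬ (arrows g).Nodup := fun h2 => h ⟨h1, h2⟩
      simp [h2]
    · simp [h1]

theorem fact_ratio (K j M : ℕ) (hj : j ≤ 2 * K) (hM : 2 * K + 2 ≤ M) :
    (((M - 1 - (2 * K)).factorial : ℚ))⁻¹ * ((M - 1 - j).factorial : ℚ) =
      ((descPochhammer ℚ (2 * K - j)).comp (X - C ((1 + j : ℕ) : ℚ))).eval (M : ℚ) := by
  have h0 : ((M - 1 - (2 * K)).factorial : ℚ) ≠ 0 := by positivity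
  rw [eval_comp]
  have : ((X - C ((1 + j : ℕ) : ℚ)) : ℚ[X]).eval (M : ℚ) = ((M - 1 - j : ℕ) : ℚ) := by
    rw [Nat.sub_sub, Nat.cast_sub (by omega)]; simp
  rw [this, descPochhammer_eval_eq_descFactorial]
  have h2 := Nat.factorial_mul_descFactorial (n := M - 1 - j) (k := 2 * K - j) (by omega)
  rw [show M - 1 - j - (2 * K - j) = M - 1 - 2 * K by omega] at h2
  rw [← h2]; push_cast; field_simp

theorem Amat_rank (K : ℕ) (F : Type) [Field F] [CharZero F] :
    ∃ (p : ℚ[X]) (M1 : ℕ), ∀ M, M1 ≤ M →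
      (((Amat K M).map (algebraMap ℚ F)).rank : ℚ) = p.eval (M : ℚ) := by
  classical
  refine rank_eventually_poly (2 * K + 2)
    (fun M => (((M - 1 - (2 * K)).factorial : ℚ))⁻¹ • (Amat K M * (Amat K M).transpose)) ?_
    (fun M => Equiv.Perm (Fin (M - 1))) (Amat K) (fun M => ((M - 1 - (2 * K)).factorial : ℚ)) ?_ F
  · intro s t
    set tf : Fin K ⊕ Fin K → Fin s := fun i => t (Sum.inl i) with htf
    set tg : Fin K ⊕ Fin K → Fin s := fun i => t (Sum.inr i) with htg
    obtain ⟨o, ho, hcount⟩ := NC_count _ (Fin s) (arrows tf ++ arrows tg) rfl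
    have hlen : (arrows tf ++ arrows tg).length = 2 * K := by
      simp [arrows_length]; omega
    by_cases hd : (arrows tf).Nodup ∧ (arrows tg).Nodup
    swap
    · refine ⟨0, fun M hM e => ?_⟩
      obtain ⟨m, rfl⟩ : ∃ m, M = m + 1 := ⟨M - 1, by omega⟩
      simp only [Matrix.smul_apply]
      rw [Amat_gram K m (by omega), if_neg]
      · simp
      · change ¬ ((arrows fun i => e (tf i)).Nodup ∧ (arrows fun i => e (tg i)).Nodup)
        rw [arrows_comp e tf, arrows_comp e tg, 
          List.nodup_map_iff (e.injective.prodMap e.injective),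
          List.nodup_map_iff (e.injective.prodMap e.injective)]
        exact hd
    have main : ∀ M, 2 * K + 2 ≤ M → ∀ e : Fin s ↪ Fin M,
      ((((M - 1 - (2 * K)).factorial : ℚ))⁻¹ • (Amat K M * (Amat K M).transpose))
        (fun i => e (tf i)) (fun i => e (tg i)) = (((M - 1 - (2 * K)).factorial : ℚ))⁻¹ *
        ((o.elim 0 (fun j => (M - 1 - j).factorial) : ℕ) : ℚ) := by
      intro M hM e
      obtain ⟨m, rfl⟩ : ∃ m, M = m + 1 := ⟨M - 1, by omega⟩
      have := hcount (Fin (m+1)) e (by rw [hlen]; simpa using hM)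
      rw [List.map_append, Fintype.card_fin] at this
      rw [Matrix.smul_apply, Amat_gram K m (by omega), if_pos, arrows_comp e tf, arrows_comp e tg,
        this, smul_eq_mul]
      rw [arrows_comp e tf, arrows_comp e tg, 
          List.nodup_map_iff (e.injective.prodMap e.injective),
          List.nodup_map_iff (e.injective.prodMap e.injective)]
      exact hd
    rcases o with _ | j
    · exact ⟨0, fun M hM e => by simpa using main M hM e⟩
    · refine ⟨_, fun M hM e => (main M hM e).trans (fact_ratio K j M ?_ hM)⟩
      rw [← hlen]; exact (ho j rfl).1
  · intro M _
    have h0 : ((M - 1 - (2 * K)).factorial : ℚ) ≠ 0 := by positivity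
    exact ⟨h0, by rw [smul_smul, mul_inv_cancel₀ h0, one_smul]⟩

/-- Consecutive pairs of a list. -/
def arr {α : Type} : List α → List (α × α)
  | [] => []
  | [_] => []
  | x :: y :: t => (x, y) :: arr (y :: t)

theorem arr_cons_append {α : Type} (x y : α) (t : List α) :
    arr (x :: y :: t) = (x, y) :: arr (y :: t) := rfl

theorem arr_length {α : Type} : ∀ l : List α, (arr l).length = l.length - 1
  | [] => rfl
  | [_] => rfl
  | x :: y :: t => by simp [arr, arr_length (y :: t)]

theorem arr_fst {α : Type} : ∀ l : List α, (arr l).map Prod.fst = l.dropLast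
  | [] => rfl
  | [_] => rfl
  | x :: y :: t => by simp [arr, arr_fst (y :: t)]

theorem arr_sub_left {α : Type} (b : List α) : ∀ a : List α, arr a ⊆ arr (a ++ b)
  | [] => by simp [arr]
  | [_] => by simp [arr]
  | x :: y :: t => by
    have := arr_sub_left b (y :: t)
    simp only [List.cons_append, arr] at this ⊢
    exact List.cons_subset_cons _ this

theorem arr_sub_right {α : Type} (b : List α) : ∀ a : List α, arr b ⊆ arr (a ++ b)
  | [] => by simp
  | x :: t => by
    refine List.Subset.trans (arr_sub_right b t) ?_
    rw [List.cons_append]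
    rcases t ++ b with _ | ⟨y, s⟩
    · simp [arr]
    · simp [arr]

theorem arr_sub_of_infix {α : Type} {a b : List α} (h : a <:+: b) : arr a ⊆ arr b := by
  obtain ⟨s, t, rfl⟩ := h
  exact List.Subset.trans (arr_sub_right a s) (arr_sub_left t _)

theorem arr_getElem {α : Type} : ∀ (l : List α) (p : α × α), p ∈ arr l →
    ∃ (i : ℕ) (h : i + 1 < l.length), p = (l[i], l[i + 1])
  | [], p, h => by simp [arr] at h
  | [_], p, h => by simp [arr] at h
  | x :: y :: t, p, h => by
    simp only [arr, List.mem_cons] at h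
    rcases h with rfl | h
    · exact ⟨0, by simp, rfl⟩
    · obtain ⟨i, hi, rfl⟩ := arr_getElem (y :: t) p h
      exact ⟨i + 1, by simpa using hi, rfl⟩

/-- The word of a permutation. -/
def wd {m : ℕ} (σ : Equiv.Perm (Fin m)) : List (Fin m) := (List.finRange m).map σ

/-- The closed path of a word. -/
def cpath {m : ℕ} (l : List (Fin m)) : List (Fin (m + 1)) := 0 :: l.map Fin.succ ++ [0]

theorem cpath_wd {m : ℕ} (σ : Equiv.Perm (Fin m)) :
    cpath (wd σ) = (List.finRange (m + 1)).map (hatP σ) ++ [0] := by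
  rw [List.finRange_succ]
  simp [cpath, wd, hatP_zero, hatP_succ]

theorem cpath_arr {m : ℕ} (σ : Equiv.Perm (Fin m)) (p : Fin (m+1) × Fin (m+1))
    (hp : p ∈ arr (cpath (wd σ))) : cyc σ p.1 = p.2 := by
  rw [cpath_wd] at hp
  obtain ⟨i, hi, rfl⟩ := arr_getElem _ _ hp
  simp only [List.length_append, List.length_map, List.length_finRange, List.length_singleton] at hi
  have hi' : i < m + 1 := by omega
  simp only
  rw [List.getElem_append_left (by simpa using hi'), List.getElem_map, cyc_hat]
  by_cases h : i + 1 < m + 1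
  · rw [List.getElem_append_left (by simpa using h), List.getElem_map]
    congr 1
    ext
    simp [Fin.val_add, Nat.mod_eq_of_lt h]
  · rw [List.getElem_append_right (by simpa using h)]
    have : i = m := by omega
    subst this
    simp only [List.getElem_finRange, List.getElem_singleton]
    have : (Fin.cast (by simp) (⟨i, by simp⟩ : Fin (List.finRange (i+1)).length) + 1 : Fin (i+1)) = 0 := by
      ext; simp [Fin.val_add]
    simpa [hatP_zero] using congrArg (hatP σ) this

theorem cpath_fst {m : ℕ} (σ : Equiv.Perm (Fin m)) :
    (arr (cpath (wd σ))).map Prod.fst = (List.finRange (m + 1)).map (hatP σ) := by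
  rw [arr_fst, cpath_wd, List.dropLast_concat]

theorem cpath_nodup {m : ℕ} (σ : Equiv.Perm (Fin m)) : (arr (cpath (wd σ))).Nodup := by
  apply List.Nodup.of_map Prod.fst
  rw [cpath_fst]
  exact (List.nodup_finRange _).map (hatP σ).injective

theorem mem_cpath_arr {m : ℕ} (σ : Equiv.Perm (Fin m)) (x y : Fin (m+1)) (h : cyc σ x = y) :
    (x, y) ∈ arr (cpath (wd σ)) := by
  have : x ∈ (arr (cpath (wd σ))).map Prod.fst := by
    rw [cpath_fst, List.mem_map]
    exact ⟨(hatP σ).symm x, List.mem_finRange _, by simp⟩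
  obtain ⟨⟨x', y'⟩, hp, rfl⟩ := List.mem_map.1 this
  have := cpath_arr σ _ hp
  simp only at this h
  rw [← h, this]
  exact hp

theorem exists_wd {m : ℕ} (l : List (Fin m)) (h : l.Perm (List.finRange m)) :
    ∃ σ : Equiv.Perm (Fin m), wd σ = l := by
  have hlen : l.length = m := by simpa using h.length_eq
  have hnd : l.Nodup := h.symm.nodup (List.nodup_finRange m)
  have hinj : Function.Injective (fun i : Fin m => l.get (i.cast hlen.symm)) := by
    intro i j hij
    have := (List.nodup_iff_injective_get.1 hnd) hij
    simpa using this
  refine ⟨Equiv.ofBijective _ (Finite.injective_iff_bijective.1 hinj), ?_⟩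
  apply List.ext_getElem
  · simp [wd, hlen]
  · intro i h1 h2
    simp [wd]

theorem flatten_inj {α : Type} [DecidableEq α] {n : ℕ} (ws : Fin n → List α) (hne : ∀ i, ws i ≠ [])
    (hnd : (List.ofFn ws).flatten.Nodup) (τ τ' : Equiv.Perm (Fin n))
    (h : (List.ofFn (fun i => ws (τ i))).flatten = (List.ofFn (fun i => ws (τ' i))).flatten) :
    τ = τ' := by
  classical
  rw [List.nodup_flatten] at hnd
  obtain ⟨hn1, hn2⟩ := hnd
  have hn1' : ∀ i, (ws i).Nodup := fun i => hn1 _ (by simp [List.mem_ofFn])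
  rw [List.pairwise_ofFn] at hn2
  have huniq : ∀ i j x, x ∈ ws i → x ∈ ws j → i = j := by
    intro i j x hi hj
    rcases lt_trichotomy i j with hlt | heq | hlt
    · exact absurd hj (fun hj => (hn2 hlt) hi hj)
    · exact heq
    · exact absurd hi (fun hi => (hn2 hlt) hj hi)
  let φ : α → Option (Fin n) := fun x =>
    if h : ∃ i, (ws i).head? = some x then some h.choose else none
  have hφ : ∀ i, (ws i).filterMap φ = [i] := by
    intro i
    have hni := hn1' i
    have hu := huniq i
    rcases hw : ws i with _ | ⟨a, t⟩
    · exact absurd hw (hne i)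
    · rw [hw] at hni hu
      have h1 : φ a = some i := by
        have hex : ∃ i, (ws i).head? = some a := ⟨i, by rw [hw]; rfl⟩
        simp only [φ, dif_pos hex, Option.some.injEq]
        have := List.mem_of_mem_head? (Option.mem_def.2 hex.choose_spec)
        exact (hu _ a (by simp) this).symm
      have h2 : ∀ x ∈ t, φ x = none := by
        intro x hx
        have hex : ¬ ∃ i, (ws i).head? = some x := by
          rintro ⟨j, hj⟩
          have := hu j x (by simp [hx]) (List.mem_of_mem_head? (Option.mem_def.2 hj))
          subst this
          rw [hw] at hj
          simp only [List.head?_cons, Option.some.injEq] at hj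
          subst hj
          exact (List.nodup_cons.1 hni).1 hx
        simp only [φ, dif_neg hex]
      rw [List.filterMap_cons_some h1, List.filterMap_eq_nil_iff.2 h2]
  have key : ∀ τ : Equiv.Perm (Fin n),
      ((List.ofFn (fun i => ws (τ i))).flatten).filterMap φ = List.ofFn τ := by
    intro τ
    rw [List.filterMap_flatten, List.map_ofFn]
    have : (List.filterMap φ ∘ fun i => ws (τ i)) = fun i => [τ i] := by
      funext i; simp [hφ]
    rw [this]
    have h2 : (fun i => [τ i]) = (fun x => [x]) ∘ τ := rfl
    rw [h2, ← List.map_ofFn]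
    induction List.ofFn τ with
    | nil => rfl
    | cons a t ih => simp [ih]
  have := congrArg (List.filterMap φ) h
  rw [key, key] at this
  exact Equiv.ext (congrFun (List.ofFn_injective this))

theorem flatten_perm {α : Type} {n : ℕ} (ws : Fin n → List α) (τ : Equiv.Perm (Fin n)) :
    (List.ofFn (fun i => ws (τ i))).flatten.Perm (List.ofFn ws).flatten :=
  (Equiv.Perm.ofFn_comp_perm τ ws).flatten

theorem block_infix {α : Type} {n : ℕ} (ws : Fin n → List α) (i : Fin n) :
    ws i <:+: (List.ofFn ws).flatten := by
  exact List.infix_of_mem_flatten (by simp [List.mem_ofFn])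

/-- A block decomposition of the set of letters `Fin m`. -/
def IsDec {m n : ℕ} (u : List (Fin m)) (ws : Fin n → List (Fin m)) (v : List (Fin m)) : Prop :=
  (∀ i, ws i ≠ []) ∧ (u ++ (List.ofFn ws).flatten ++ v).Perm (List.finRange m)

open Classical in
theorem lemX {E : Type} [AddCommMonoid E] (n K m : ℕ) (hn : 1 ≤ n) (hm : m = n + K)
    (u v : List (Fin m)) (ws : Fin n → List (Fin m)) (hdec : IsDec u ws v)
    (L : List (Fin (m+1) × Fin (m+1))) (hLn : L.Nodup) (hLl : L.length = K)
    (hL : ∀ p ∈ L, p ∈ arr (0 :: u.map Fin.succ) ∨ (∃ i, p ∈ arr ((ws i).map Fin.succ)) ∨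
      p ∈ arr (v.map Fin.succ ++ [0])) (g : List (Fin m) → E) :
    ∑ τ : Equiv.Perm (Fin n), g (u ++ (List.ofFn (fun i => ws (τ i))).flatten ++ v) =
      ∑ σ : Equiv.Perm (Fin m), if (∀ p ∈ L, cyc σ p.1 = p.2) then g (wd σ) else 0 := by
  obtain ⟨hne, hperm⟩ := hdec
  have h1 : ∀ τ : Equiv.Perm (Fin n), ∃ σ : Equiv.Perm (Fin m),
      wd σ = u ++ (List.ofFn (fun i => ws (τ i))).flatten ++ v := by
    intro τ
    apply exists_wd
    refine List.Perm.trans ?_ hperm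
    exact ((flatten_perm ws τ).append_left u).append_right v
  choose s hs using h1
  have hcompat : ∀ τ, ∀ p ∈ L, cyc (s τ) p.1 = p.2 := by
    intro τ p hp
    apply cpath_arr
    rw [hs τ]
    rcases hL p hp with h | ⟨i, h⟩ | h
    · refine arr_sub_of_infix ?_ h
      refine ⟨[], ((List.ofFn (fun i => ws (τ i))).flatten ++ v).map Fin.succ ++ [0], ?_⟩
      simp [cpath]
    · refine arr_sub_of_infix ?_ h
      have hb := block_infix (fun i => ws (τ i)) (τ.symm i)
      simp only [Equiv.apply_symm_apply] at hb
      obtain ⟨a, b, hab⟩ := hb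
      refine ⟨0 :: (u ++ a).map Fin.succ, (b ++ v).map Fin.succ ++ [0], ?_⟩
      rw [← hab]
      simp [cpath]
    · refine arr_sub_of_infix ?_ h
      refine ⟨0 :: (u ++ (List.ofFn (fun i => ws (τ i))).flatten).map Fin.succ, [], ?_⟩
      simp [cpath]
  have hsinj : Function.Injective s := by
    intro τ τ' h
    have h2 := hs τ
    rw [h, hs τ'] at h2
    have h3 := List.append_cancel_left (List.append_cancel_right h2)
    refine flatten_inj ws hne ?_ τ τ' h3.symm
    have hnd := hperm.symm.nodup (List.nodup_finRange m)
    exact ((List.nodup_append.1 (List.nodup_append.1 hnd).1).2).1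
  have hcard : (Finset.univ.filter fun σ : Equiv.Perm (Fin m) => ∀ p ∈ L, cyc σ p.1 = p.2).card
      = n.factorial := by
    rw [← Fintype.card_subtype, ← Nat.card_eq_fintype_card, card_compat (by omega)]
    obtain ⟨o, ho, hcount⟩ := NC_count _ (Fin (m+1)) L rfl
    have hc := hcount (Fin (m+1)) (Function.Embedding.refl _) (by rw [hLl, Fintype.card_fin]; omega)
    have hid : L.map (Prod.map (Function.Embedding.refl (Fin (m+1)))
      (Function.Embedding.refl (Fin (m+1)))) = L := by
      conv_rhs => rw [← List.map_id L]
      rfl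
    rw [hid] at hc
    have hpos : NC (Fin (m+1)) L ≠ 0 := by
      rw [← card_compat (by omega)]
      have : Nonempty {σ : Equiv.Perm (Fin m) // ∀ p ∈ L, cyc σ p.1 = p.2} := ⟨⟨s 1, hcompat 1⟩⟩
      exact Nat.card_pos.ne'
    rcases o with _ | j
    · exact absurd hc hpos
    · have hj : j = K := by rw [← hLl]; exact (ho j rfl).2 hLn
      rw [hc]
      simp only [Option.elim_some, Fintype.card_fin]
      congr 1
      omega
  have himg : Finset.univ.image s =
      Finset.univ.filter fun σ : Equiv.Perm (Fin m) => ∀ p ∈ L, cyc σ p.1 = p.2 := by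
    apply Finset.eq_of_subset_of_card_le
    · intro σ hσ
      obtain ⟨τ, -, rfl⟩ := Finset.mem_image.1 hσ
      simpa only [Finset.mem_filter, Finset.mem_univ, true_and] using hcompat τ
    · rw [hcard, Finset.card_image_of_injective _ hsinj, Finset.card_univ, Fintype.card_perm,
        Fintype.card_fin]
  rw [← Finset.sum_filter, ← himg, Finset.sum_image (fun a _ b _ h => hsinj h)]
  exact Finset.sum_congr rfl fun τ _ => by rw [hs τ]

open Classical in
/-- The row of the incidence matrix evaluated against a function of words. -/
noncomputable def rowS {E : Type} [AddCommMonoid E] {K m : ℕ} (g : List (Fin m) → E)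
    (f : Fin K ⊕ Fin K → Fin (m + 1)) : E :=
  ∑ σ : Equiv.Perm (Fin m), if ((arrows f).Nodup ∧ ∀ p ∈ arrows f, cyc σ p.1 = p.2)
    then g (wd σ) else 0

theorem exists_arrows {α : Type} {K : ℕ} (L : List (α × α)) (h : L.length = K) :
    ∃ f : Fin K ⊕ Fin K → α, arrows f = L := by
  subst h
  refine ⟨Sum.elim (fun i => (L.get i).1) (fun i => (L.get i).2), ?_⟩
  simp [arrows]

theorem gen_is_row {E : Type} [AddCommMonoid E] (n K m : ℕ) (hn : 1 ≤ n) (hm : m = n + K)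
    (u v : List (Fin m)) (ws : Fin n → List (Fin m)) (hdec : IsDec u ws v)
    (g : List (Fin m) → E) :
    ∃ f : Fin K ⊕ Fin K → Fin (m + 1),
    ∑ τ : Equiv.Perm (Fin n), g (u ++ (List.ofFn (fun i => ws (τ i))).flatten ++ v) = rowS g f := by
  classical
  set L := arr (0 :: u.map Fin.succ) ++
    ((List.ofFn ws).map (fun w => arr (w.map Fin.succ))).flatten ++ arr (v.map Fin.succ ++ [0]) with hLdef
  have hflen : ∀ W : List (List (Fin m)), (∀ w ∈ W, w ≠ []) →
      (W.map (fun w => arr (w.map Fin.succ))).flatten.length + W.length = W.flatten.length := by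
    intro W hW
    induction W with
    | nil => rfl
    | cons w t ih =>
      have h1 := ih (fun w hw => hW w (List.mem_cons_of_mem _ hw))
      have h2 : w.length ≠ 0 := by
        have := hW w (by simp)
        simpa using this
      simp only [List.map_cons, List.flatten_cons, List.length_append, List.length_cons, arr_length,
        List.length_map] at h1 ⊢
      omega
  have hlen : L.length = K := by
    have h1 := hflen (List.ofFn ws) (by
      intro w hw
      obtain ⟨i, rfl⟩ := (List.mem_ofFn' _ _).1 hw
      exact hdec.1 i)
    have h2 := hdec.2.length_eq
    rw [List.length_ofFn] at h1
    simp only [List.length_append, List.length_finRange] at h2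
    simp only [hLdef, List.length_append, arr_length, List.length_cons, List.length_map,
      List.length_nil]
    omega
  have hfsub : ∀ W : List (List (Fin m)), 
      ((W.map (fun w => arr (w.map Fin.succ))).flatten.map Prod.fst).Sublist
        (W.flatten.map Fin.succ) := by
    intro W
    induction W with
    | nil => simp
    | cons w t ih =>
      simp only [List.map_cons, List.flatten_cons, List.map_append, arr_fst]
      exact (List.dropLast_sublist _).append ih
  have hnd : L.Nodup := by
    apply List.Nodup.of_map Prod.fst
    have hbig : (0 :: (u ++ (List.ofFn ws).flatten ++ v).map Fin.succ).Nodup := by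
      rw [List.nodup_cons]
      refine ⟨?_, ?_⟩
      · simp [Fin.succ_ne_zero]
      · exact (hdec.2.symm.nodup (List.nodup_finRange m)).map (Fin.succ_injective m)
    refine List.Nodup.sublist ?_ hbig
    simp only [hLdef, List.map_append, arr_fst, List.dropLast_concat]
    rw [← List.cons_append, ← List.cons_append]
    exact ((List.dropLast_sublist _).append (hfsub _)).append (List.Sublist.refl _)
  obtain ⟨f, hf⟩ := exists_arrows L hlen
  refine ⟨f, ?_⟩
  rw [lemX n K m hn hm u v ws hdec L hnd hlen ?_ g]
  · unfold rowS
    rw [hf]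
    simp only [hnd, true_and]
  · intro p hp
    simp only [hLdef, List.mem_append, List.mem_flatten, List.mem_map, List.mem_ofFn] at hp
    rcases hp with (h | ⟨l, ⟨a, ⟨i, rfl⟩, rfl⟩, h⟩) | h
    · exact Or.inl h
    · exact Or.inr (Or.inl ⟨i, h⟩)
    · exact Or.inr (Or.inr h)

theorem cutting {α β : Type} (s : α → β) (z : β) (S : β × β → Bool) :
    ∀ (l : List α) (a : β), (∀ p ∈ arr (a :: (l.map s ++ [z])), S p = true) ∨
      ∃ (u : List α) (ws : List (List α)) (v : List α), l = u ++ ws.flatten ++ v ∧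
        (∀ w ∈ ws, w ≠ []) ∧
        (∀ p ∈ arr (a :: (l.map s ++ [z])), S p = true → p ∈ arr (a :: u.map s) ∨
          (∃ w ∈ ws, p ∈ arr (w.map s)) ∨ p ∈ arr (v.map s ++ [z])) ∧
        (arr (a :: (l.map s ++ [z]))).countP (fun p => !S p) = ws.length + 1 := by
  intro l
  induction l with
  | nil =>
    intro a
    by_cases h : S (a, z) = true
    · left; simpa [arr] using h
    · right
      refine ⟨[], [], [], rfl, by simp, ?_, ?_⟩
      · simp [arr, h]
      · simp [arr, h]
  | cons b l ih =>
    intro a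
    have harr : arr (a :: ((b :: l).map s ++ [z])) = (a, s b) :: arr (s b :: (l.map s ++ [z])) := rfl
    rw [harr]
    rcases ih (s b) with hall | ⟨u, ws, v, hl, hne, hp, hc⟩
    · by_cases h : S (a, s b) = true
      · left
        intro p hp
        rcases List.mem_cons.1 hp with rfl | hp
        · exact h
        · exact hall p hp
      · right
        refine ⟨[], [], b :: l, by simp, by simp, ?_, ?_⟩
        · intro p hp hS
          rcases List.mem_cons.1 hp with rfl | hp
          · exact absurd hS h
          · exact Or.inr (Or.inr hp)
        · rw [List.countP_cons_of_pos (by simpa using h)]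
          simp only [List.length_nil, Nat.add_eq_right]
          rw [List.countP_eq_zero]
          intro p hp
          simp [hall p hp]
    · right
      by_cases h : S (a, s b) = true
      · refine ⟨b :: u, ws, v, by simp [hl], hne, ?_, ?_⟩
        · intro p hp' hS
          rcases List.mem_cons.1 hp' with rfl | hp'
          · left; simp [arr]
          · rcases hp p hp' hS with h1 | h1
            · left
              simp only [List.map_cons, arr, List.mem_cons]
              exact Or.inr h1
            · exact Or.inr h1
        · rw [List.countP_cons_of_neg (by simpa using h)]
          exact hc
      · refine ⟨[], (b :: u) :: ws, v, by simp [hl], ?_, ?_, ?_⟩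
        · intro w hw
          rcases List.mem_cons.1 hw with rfl | hw
          · simp
          · exact hne w hw
        · intro p hp' hS
          rcases List.mem_cons.1 hp' with rfl | hp'
          · exact absurd hS h
          · rcases hp p hp' hS with h1 | ⟨w, hw, h1⟩ | h1
            · exact Or.inr (Or.inl ⟨b :: u, by simp, h1⟩)
            · exact Or.inr (Or.inl ⟨w, by simp [hw], h1⟩)
            · exact Or.inr (Or.inr h1)
        · rw [List.countP_cons_of_pos (by simpa using h), hc]
          simp

theorem row_is_gen {E : Type} [AddCommMonoid E] (n K m : ℕ) (hn : 1 ≤ n) (hm : m = n + K)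
    (g : List (Fin m) → E) (f : Fin K ⊕ Fin K → Fin (m + 1)) :
    rowS g f = 0 ∨ ∃ (u v : List (Fin m)) (ws : Fin n → List (Fin m)), IsDec u ws v ∧
      rowS g f = ∑ τ : Equiv.Perm (Fin n), g (u ++ (List.ofFn (fun i => ws (τ i))).flatten ++ v) := by
  classical
  by_cases hex : ∃ σ : Equiv.Perm (Fin m), (arrows f).Nodup ∧ ∀ p ∈ arrows f, cyc σ p.1 = p.2
  swap
  · left
    unfold rowS
    refine Finset.sum_eq_zero fun σ _ => if_neg fun h => hex ⟨σ, h⟩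
  right
  obtain ⟨σ, hnd, hσ⟩ := hex
  set L := arrows f with hL
  have hlen : L.length = K := arrows_length f
  have hsub : ∀ p ∈ L, p ∈ arr (cpath (wd σ)) := fun p hp => mem_cpath_arr σ p.1 p.2 (hσ p hp)
  have hcnt : (arr (cpath (wd σ))).countP (fun p => decide (p ∈ L)) = K := by
    rw [List.countP_eq_length_filter, ← hlen]
    apply List.Perm.length_eq
    rw [List.perm_ext_iff_of_nodup ((cpath_nodup σ).filter _) hnd]
    intro p
    simp only [List.mem_filter, decide_eq_true_eq]
    exact ⟨fun h => h.2, fun h => ⟨hsub p h, h⟩⟩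
  have htot : (arr (cpath (wd σ))).length = m + 1 := by
    rw [arr_length]; simp [cpath, wd]
  have hsum := List.length_eq_countP_add_countP (fun p => decide (p ∈ L)) (l := arr (cpath (wd σ)))
  rcases cutting Fin.succ (0 : Fin (m+1)) (fun p => decide (p ∈ L)) (wd σ) 0 with
    hall | ⟨u, ws, v, hl, hne, hp, hc⟩
  · exfalso
    have : (arr (cpath (wd σ))).countP (fun p => decide (p ∈ L)) = (arr (cpath (wd σ))).length :=
      List.countP_eq_length.2 hall
    omega
  · have hwlen : ws.length = n := by
      have hc' : (arr (cpath (wd σ))).countP (fun p => !decide (p ∈ L)) = ws.length + 1 := hc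
      have : (fun p : Fin (m+1) × Fin (m+1) => decide (¬ (decide (p ∈ L) = true))) = fun p => !decide (p ∈ L) := by
        funext p; simp
      rw [this, hc', hcnt, htot] at hsum
      omega
    subst hwlen
    have hof : List.ofFn ws.get = ws := List.ofFn_get ws
    have hdec : IsDec u ws.get v := by
      refine ⟨fun i => hne _ (List.get_mem ws i), ?_⟩
      rw [hof, ← hl, wd]
      exact Equiv.Perm.map_finRange_perm σ
    refine ⟨u, v, ws.get, hdec, ?_⟩
    rw [lemX _ K m hn hm u v ws.get hdec L hnd hlen ?_ g]
    · unfold rowS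
      rw [← hL]
      simp only [hnd, true_and]
    · intro p hpL
      rcases hp p (hsub p hpL) (by simpa using hpL) with h | ⟨w, hw, h⟩ | h
      · exact Or.inl h
      · obtain ⟨i, rfl⟩ := List.get_of_mem hw
        exact Or.inr (Or.inl ⟨i, h⟩)
      · exact Or.inr (Or.inr h)

/-- The unital free algebra. -/
abbrev FreeB (F : Type) [Field F] : Type := MonoidAlgebra F (FreeMonoid ℕ)

/-- Monomials in the unital free algebra. -/
noncomputable def bW (F : Type) [Field F] (l : List ℕ) : FreeB F :=
  MonoidAlgebra.single (FreeMonoid.ofList l) 1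

theorem bW_nil (F : Type) [Field F] : bW F [] = 1 := rfl

theorem bW_append (F : Type) [Field F] (a b : List ℕ) : bW F (a ++ b) = bW F a * bW F b := by
  simp [bW, MonoidAlgebra.single_mul_single]

theorem bW_flatten (F : Type) [Field F] (W : List (List ℕ)) :
    bW F W.flatten = (W.map (bW F)).prod := by
  induction W with
  | nil => rfl
  | cons w t ih => rw [List.flatten_cons, bW_append, ih, List.map_cons, List.prod_cons]

/-- The embedding of the non-unital free algebra. -/
noncomputable def iB (F : Type) [Field F] : FreeNA F →ₙₐ[F] FreeB F :=
  MonoidAlgebra.liftMagma F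
    ((MonoidAlgebra.of F (FreeMonoid ℕ) : FreeMonoid ℕ →ₙ* FreeB F).comp
      (FreeSemigroup.lift (FreeMonoid.of (α := ℕ))))

theorem fs_lift (a : ℕ) (t : List ℕ) :
    FreeSemigroup.lift (FreeMonoid.of (α := ℕ)) ⟨a, t⟩ = FreeMonoid.ofList (a :: t) := by
  induction t generalizing a with
  | nil => rfl
  | cons b t ih =>
    have : (⟨a, b :: t⟩ : FreeSemigroup ℕ) = FreeSemigroup.of a * ⟨b, t⟩ := rfl
    rw [this, map_mul, ih]
    rfl

theorem iB_x (F : Type) [Field F] (l : List ℕ) (hl : l ≠ []) : iB F (xList F l) = bW F l := by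
  rcases l with _ | ⟨a, t⟩
  · exact absurd rfl hl
  · simp [iB, xList, bW, MonoidAlgebra.liftMagma_apply_apply, fs_lift]

theorem basis_bW (F : Type) [Field F] (l : List ℕ) :
    MonoidAlgebra.basis (FreeMonoid ℕ) F (FreeMonoid.ofList l) = bW F l := rfl

theorem basis_x (F : Type) [Field F] (a : ℕ) (t : List ℕ) :
    MonoidAlgebra.basis (FreeSemigroup ℕ) F ⟨a, t⟩ = xList F (a :: t) := rfl

/-- Linear maps out of the unital free algebra. -/
noncomputable def liftB (F : Type) [Field F] (g : List ℕ → FreeNA F) : FreeB F →ₗ[F] FreeNA F :=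
  (MonoidAlgebra.basis (FreeMonoid ℕ) F).constr F (fun w => g w.toList)

theorem liftB_bW (F : Type) [Field F] (g : List ℕ → FreeNA F) (l : List ℕ) :
    liftB F g (bW F l) = g l := by
  rw [liftB, ← basis_bW, Module.Basis.constr_basis]; rfl

theorem iB_injective (F : Type) [Field F] : Function.Injective (iB F) := by
  have : ∀ x, liftB F (xList F) (iB F x) = x := by
    intro x
    have : (liftB F (xList F)) ∘ₗ (iB F : FreeNA F →ₗ[F] FreeB F) = LinearMap.id := by
      apply (MonoidAlgebra.basis (FreeSemigroup ℕ) F).ext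
      rintro ⟨a, t⟩
      rw [basis_x]
      change liftB F (xList F) (iB F _) = _
      rw [iB_x F _ (by simp), liftB_bW]; rfl
    exact LinearMap.congr_fun this x
  exact Function.LeftInverse.injective this

/-- The symmetrized product. -/
noncomputable def PM (F : Type) [Field F] (n : ℕ) :
    MultilinearMap F (fun _ : Fin n => FreeB F) (FreeB F) :=
  ∑ τ : Equiv.Perm (Fin n), (MultilinearMap.mkPiAlgebraFin F n (FreeB F)).domDomCongr τ

theorem PM_apply (F : Type) [Field F] (n : ℕ) (f : Fin n → FreeB F) :
    PM F n f = ∑ τ : Equiv.Perm (Fin n), (List.ofFn (fun i => f (τ i))).prod := by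
  simp [PM, MultilinearMap.mkPiAlgebraFin_apply]

theorem gen_eq (F : Type) [Field F] (n : ℕ) (u v : List ℕ) (ws : Fin n → List ℕ) :
    bW F u * PM F n (fun i => bW F (ws i)) * bW F v =
      ∑ τ : Equiv.Perm (Fin n), bW F (u ++ (List.ofFn (fun i => ws (τ i))).flatten ++ v) := by
  rw [PM_apply, Finset.mul_sum, Finset.sum_mul]
  refine Finset.sum_congr rfl fun τ _ => ?_
  rw [bW_append, bW_append, bW_flatten, List.map_ofFn]
  rfl

open Finset in
theorem polarization (F : Type) [Field F] (n : ℕ) (f : Fin n → FreeB F) :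
    PM F n f = ∑ T : Finset (Fin n), ((-1 : ℤ) ^ T.card) • (∑ i ∈ Tᶜ, f i) ^ n := by
  classical
  have h1 : ∀ T : Finset (Fin n), (∑ i ∈ Tᶜ, f i) ^ n =
      ∑ r : Fin n → Fin n, if T ⊆ (univ.image r)ᶜ then (List.ofFn (fun i => f (r i))).prod else 0 := by
    intro T
    have := (MultilinearMap.mkPiAlgebraFin F n (FreeB F)).map_sum_finset
      (fun _ j => f j) (fun _ : Fin n => Tᶜ)
    simp only [MultilinearMap.mkPiAlgebraFin_apply, List.ofFn_const, List.prod_replicate] at this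
    rw [this, ← Finset.sum_filter]
    refine Finset.sum_congr ?_ fun _ _ => rfl
    ext r
    simp only [Fintype.mem_piFinset, mem_compl, mem_filter, mem_univ, true_and]
    constructor
    · intro h x hx
      simp only [mem_compl, mem_image, mem_univ, true_and, not_exists]
      rintro i rfl
      exact h i hx
    · intro h i hi
      have := h hi
      simp at this
  simp_rw [h1, Finset.smul_sum]
  rw [Finset.sum_comm]
  have h2 : ∀ r : Fin n → Fin n, (∑ T : Finset (Fin n), ((-1 : ℤ) ^ T.card) •
      (if T ⊆ (univ.image r)ᶜ then (List.ofFn (fun i => f (r i))).prod else 0)) =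
      if Function.Surjective r then (List.ofFn (fun i => f (r i))).prod else 0 := by
    intro r
    simp only [smul_ite, smul_zero]
    rw [← Finset.sum_filter, ← Finset.sum_smul]
    have : (univ.filter fun T : Finset (Fin n) => T ⊆ (univ.image r)ᶜ) = ((univ.image r)ᶜ).powerset := by
      ext T; simp
    rw [this, Finset.sum_powerset_neg_one_pow_card]
    have h3 : (univ.image r)ᶜ = ∅ ↔ Function.Surjective r := by
      simp [Finset.eq_univ_iff_forall, Function.Surjective]
    simp only [h3]
    split_ifs <;> simp
  rw [Finset.sum_congr rfl fun r _ => h2 r, ← Finset.sum_filter, PM_apply]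
  refine Finset.sum_bij (fun τ _ => ⇑τ) ?_ ?_ ?_ ?_
  · intro τ _; simpa using τ.surjective
  · intro a _ b _ h; exact DFunLike.coe_injective h
  · intro r hr
    have hr' : Function.Surjective r := by simpa using hr
    exact ⟨Equiv.ofBijective r (Finite.surjective_iff_bijective.1 hr'), mem_univ _, rfl⟩
  · intro τ _; rfl

/-- The ideal spanned by all generators. -/
noncomputable def JB (F : Type) [Field F] (n : ℕ) : Submodule F (FreeB F) :=
  Submodule.span F {y | ∃ (u v : List ℕ) (ws : Fin n → List ℕ), (∀ i, ws i ≠ []) ∧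
    y = bW F u * PM F n (fun i => bW F (ws i)) * bW F v}

theorem span_bW (F : Type) [Field F] : Submodule.span F (Set.range (bW F)) = ⊤ := by
  rw [← (MonoidAlgebra.basis (FreeMonoid ℕ) F).span_eq]
  rfl

theorem JB_mul_left (F : Type) [Field F] (n : ℕ) (a y : FreeB F) (hy : y ∈ JB F n) :
    a * y ∈ JB F n := by
  have ha : a ∈ Submodule.span F (Set.range (bW F)) := by rw [span_bW]; trivial
  induction ha using Submodule.span_induction with
  | mem x hx =>
    obtain ⟨w, rfl⟩ := hx
    unfold JB at hy
    induction hy using Submodule.span_induction with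
    | mem y hy =>
      obtain ⟨u, v, ws, h, rfl⟩ := hy
      refine Submodule.subset_span ⟨w ++ u, v, ws, h, ?_⟩
      rw [bW_append]; simp only [mul_assoc]
    | zero => simp
    | add x y _ _ h1 h2 => rw [mul_add]; exact add_mem h1 h2
    | smul c x _ h => rw [mul_smul_comm]; exact Submodule.smul_mem _ _ h
  | zero => simp
  | add x y _ _ h1 h2 => rw [add_mul]; exact add_mem h1 h2
  | smul c x _ h => rw [smul_mul_assoc]; exact Submodule.smul_mem _ _ h

theorem JB_mul_right (F : Type) [Field F] (n : ℕ) (a y : FreeB F) (hy : y ∈ JB F n) :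
    y * a ∈ JB F n := by
  have ha : a ∈ Submodule.span F (Set.range (bW F)) := by rw [span_bW]; trivial
  induction ha using Submodule.span_induction with
  | mem x hx =>
    obtain ⟨w, rfl⟩ := hx
    unfold JB at hy
    induction hy using Submodule.span_induction with
    | mem y hy =>
      obtain ⟨u, v, ws, h, rfl⟩ := hy
      refine Submodule.subset_span ⟨u, v ++ w, ws, h, ?_⟩
      rw [bW_append]; simp only [mul_assoc]
    | zero => simp
    | add x y _ _ h1 h2 => rw [add_mul]; exact add_mem h1 h2
    | smul c x _ h => rw [smul_mul_assoc]; exact Submodule.smul_mem _ _ h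
  | zero => simp
  | add x y _ _ h1 h2 => rw [mul_add]; exact add_mem h1 h2
  | smul c x _ h => rw [mul_smul_comm]; exact Submodule.smul_mem _ _ h

theorem PM_mem_JB (F : Type) [Field F] (n : ℕ) (g : Fin n → FreeNA F) :
    PM F n (fun i => iB F (g i)) ∈ JB F n := by
  have key : (JB F n).mkQ.compMultilinearMap
      ((PM F n).compLinearMap (fun _ => (iB F : FreeNA F →ₗ[F] FreeB F))) = 0 := by
    refine Module.Basis.ext_multilinear (fun _ => MonoidAlgebra.basis (FreeSemigroup ℕ) F) ?_
    intro v
    simp only [LinearMap.compMultilinearMap_apply, MultilinearMap.compLinearMap_apply,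
      zero_apply]
    rw [Submodule.mkQ_apply, Submodule.Quotient.mk_eq_zero]
    refine Submodule.subset_span ⟨[], [], fun i => (v i).head :: (v i).tail, by simp, ?_⟩
    rw [bW_nil, one_mul, mul_one]
    congr 1
    funext i
    change iB F (xList F ((v i).head :: (v i).tail)) = _
    exact iB_x F _ (by simp)
  have := congrArg (fun φ => φ g) key
  simp only [LinearMap.compMultilinearMap_apply, MultilinearMap.compLinearMap_apply,
      zero_apply] at this
  rw [Submodule.mkQ_apply, Submodule.Quotient.mk_eq_zero] at this
  exact this

/-- Bundling a multiplicative linear endomorphism. -/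
noncomputable def bundleNA (F : Type) [Field F] (ψ : FreeNA F →ₗ[F] FreeNA F)
    (h : ∀ x y : FreeNA F, ψ (x * y) = ψ x * ψ y) : FreeNA F →ₙₐ[F] FreeNA F :=
  { toFun := ψ, map_smul' := fun c x => by simp, map_zero' := map_zero ψ,
    map_add' := map_add ψ, map_mul' := h }

/-- Extension of an endomorphism to the unital algebra. -/
noncomputable def extB (F : Type) [Field F] (ψ : FreeNA F →ₗ[F] FreeNA F) : FreeB F →ₐ[F] FreeB F :=
  MonoidAlgebra.lift F (FreeB F) (FreeMonoid ℕ) (FreeMonoid.lift fun i => iB F (ψ (xList F [i])))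

theorem extB_iB (F : Type) [Field F] (ψ : FreeNA F →ₗ[F] FreeNA F)
    (h : ∀ x y : FreeNA F, ψ (x * y) = ψ x * ψ y) (x : FreeNA F) :
    extB F ψ (iB F x) = iB F (ψ x) := by
  have : ((extB F ψ : FreeB F →ₙₐ[F] FreeB F).comp (iB F)) = (iB F).comp (bundleNA F ψ h) := by
    apply MonoidAlgebra.nonUnitalAlgHom_ext'
    apply FreeSemigroup.hom_ext
    funext i
    change extB F ψ (iB F (xList F [i])) = iB F (ψ (xList F [i]))
    rw [iB_x F _ (by simp)]
    simp [extB, bW, MonoidAlgebra.lift_single]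
  exact DFunLike.congr_fun this x

theorem JB_isT (F : Type) [Field F] (n : ℕ) :
    IsTIdeal F ((JB F n).comap (iB F : FreeNA F →ₗ[F] FreeB F)) := by
  refine ⟨fun a b hb => ?_, fun ψ hψ a ha => ?_⟩
  · have hb' : iB F b ∈ JB F n := hb
    constructor
    · change iB F (a * b) ∈ JB F n
      rw [map_mul]; exact JB_mul_left F n _ _ hb'
    · change iB F (b * a) ∈ JB F n
      rw [map_mul]; exact JB_mul_right F n _ _ hb'
  · have ha' : iB F a ∈ JB F n := ha
    change iB F (ψ a) ∈ JB F n
    rw [← extB_iB F ψ hψ]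
    generalize iB F a = y at ha'
    unfold JB at ha'
    induction ha' using Submodule.span_induction with
    | mem y hy =>
      obtain ⟨u, v, ws, h, rfl⟩ := hy
      rw [map_mul, map_mul]
      apply JB_mul_right
      apply JB_mul_left
      have : extB F ψ (PM F n fun i => bW F (ws i)) =
          PM F n (fun i => iB F (ψ (xList F (ws i)))) := by
        rw [PM_apply, PM_apply, map_sum]
        refine Finset.sum_congr rfl fun τ _ => ?_
        rw [map_list_prod, List.map_ofFn]
        congr 2
        funext i
        simp only [Function.comp_apply]
        rw [← extB_iB F ψ hψ, iB_x F _ (h _)]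
      rw [this]
      exact PM_mem_JB F n _
    | zero => simp
    | add x y _ _ h1 h2 => rw [map_add]; exact add_mem h1 h2
    | smul c x _ h => rw [map_smul]; exact Submodule.smul_mem _ _ h

theorem bW_replicate (F : Type) [Field F] (n a : ℕ) : bW F (List.replicate n a) = bW F [a] ^ n := by
  induction n with
  | zero => rfl
  | succ n ih => rw [List.replicate_succ, ← List.singleton_append, bW_append, ih, pow_succ']

theorem TGen_le (F : Type) [Field F] [CharZero F] (n : ℕ) (hn : 1 ≤ n) :
    TIdealGen F (xList F (List.replicate n 0)) ≤
      (JB F n).comap (iB F : FreeNA F →ₗ[F] FreeB F) := by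
  apply sInf_le
  refine ⟨JB_isT F n, ?_⟩
  change iB F (xList F (List.replicate n 0)) ∈ JB F n
  rw [iB_x F _ (by simp; omega), bW_replicate]
  have h1 : PM F n (fun _ => bW F [0]) ∈ JB F n :=
    Submodule.subset_span ⟨[], [], fun _ => [0], by simp, by simp [bW_nil]⟩
  have h2 : PM F n (fun _ => bW F [0]) = (n.factorial : F) • bW F [0] ^ n := by
    rw [PM_apply]
    simp [Fintype.card_perm, Nat.cast_smul_eq_nsmul]
  rw [h2] at h1
  exact (Submodule.smul_mem_iff _ (by exact_mod_cast n.factorial_ne_zero)).1 h1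

theorem gen_mem_T (F : Type) [Field F] (n : ℕ) (hn : 1 ≤ n) (u v : List ℕ)
    (ws : Fin n → List ℕ) (h : ∀ i, ws i ≠ []) :
    ∑ τ : Equiv.Perm (Fin n), xList F (u ++ (List.ofFn (fun i => ws (τ i))).flatten ++ v) ∈
      TIdealGen F (xList F (List.replicate n 0)) := by
  unfold TIdealGen
  rw [Submodule.mem_sInf]
  rintro I ⟨⟨hI1, hI2⟩, hx⟩
  have hpow : ∀ g : FreeNA F, (iB F g) ^ n ∈ I.map (iB F : FreeNA F →ₗ[F] FreeB F) := by
    intro g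
    set Ψ : FreeNA F →ₙₐ[F] FreeNA F :=
      MonoidAlgebra.liftMagma F (FreeSemigroup.lift fun _ : ℕ => g) with hΨ
    have hmem := hI2 (Ψ : FreeNA F →ₗ[F] FreeNA F) (fun x y => map_mul Ψ x y) _ hx
    refine ⟨_, hmem, ?_⟩
    change iB F ((Ψ : FreeNA F →ₗ[F] FreeNA F) _) = _
    rw [← extB_iB F (Ψ : FreeNA F →ₗ[F] FreeNA F) (fun x y => map_mul Ψ x y),
      iB_x F _ (by simp; omega), bW_replicate, map_pow, ← iB_x F [0] (by simp),
      extB_iB F (Ψ : FreeNA F →ₗ[F] FreeNA F) (fun x y => map_mul Ψ x y)]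
    congr 2
    change Ψ (xList F [0]) = g
    have : FreeSemigroup.lift (fun _ : ℕ => g) ⟨0, []⟩ = g := rfl
    simp [hΨ, xList, MonoidAlgebra.liftMagma_apply_apply, this]
  have hleft : ∀ (w : List ℕ) y, y ∈ I.map (iB F : FreeNA F →ₗ[F] FreeB F) →
      bW F w * y ∈ I.map (iB F : FreeNA F →ₗ[F] FreeB F) := by
    intro w y hy
    by_cases hw : w = []
    · subst hw; rwa [bW_nil, one_mul]
    · obtain ⟨b, hb, rfl⟩ := hy
      refine ⟨xList F w * b, (hI1 _ b hb).1, ?_⟩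
      change iB F _ = _ * iB F b
      rw [map_mul, iB_x F w hw]
  have hright : ∀ (w : List ℕ) y, y ∈ I.map (iB F : FreeNA F →ₗ[F] FreeB F) →
      y * bW F w ∈ I.map (iB F : FreeNA F →ₗ[F] FreeB F) := by
    intro w y hy
    by_cases hw : w = []
    · subst hw; rwa [bW_nil, mul_one]
    · obtain ⟨b, hb, rfl⟩ := hy
      refine ⟨b * xList F w, (hI1 _ b hb).2, ?_⟩
      change iB F _ = iB F b * _
      rw [map_mul, iB_x F w hw]
  have hmem : bW F u * PM F n (fun i => bW F (ws i)) * bW F v ∈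
      I.map (iB F : FreeNA F →ₗ[F] FreeB F) := by
    apply hright
    apply hleft
    rw [polarization]
    refine Submodule.sum_mem _ fun T _ => ?_
    have hz : ∀ (c : ℤ) y, y ∈ I.map (iB F : FreeNA F →ₗ[F] FreeB F) →
      c • y ∈ I.map (iB F : FreeNA F →ₗ[F] FreeB F) := fun c y hy => zsmul_mem hy c
    apply hz
    have : ∑ i ∈ Tᶜ, bW F (ws i) = iB F (∑ i ∈ Tᶜ, xList F (ws i)) := by
      rw [map_sum]
      exact Finset.sum_congr rfl fun i _ => (iB_x F _ (h i)).symm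
    rw [this]
    exact hpow _
  rw [gen_eq] at hmem
  obtain ⟨b, hb, hbe⟩ := hmem
  have : b = ∑ τ : Equiv.Perm (Fin n),
      xList F (u ++ (List.ofFn (fun i => ws (τ i))).flatten ++ v) := by
    apply iB_injective F
    rw [map_sum]
    refine hbe.trans (Finset.sum_congr rfl fun τ _ => (iB_x F _ ?_).symm)
    intro hnil
    simp only [List.append_eq_nil_iff, List.flatten_eq_nil_iff] at hnil
    exact h (τ ⟨0, hn⟩) (hnil.1.2 _ (by simp [List.mem_ofFn]))
  rw [← this]; exact hb

/-- Evaluation of a word over `Fin m`. -/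
noncomputable def gX (F : Type) [Field F] (m : ℕ) (l : List (Fin m)) : FreeNA F :=
  xList F (l.map Fin.val)

theorem gX_wd (F : Type) [Field F] (m : ℕ) (σ : Equiv.Perm (Fin m)) :
    gX F m (wd σ) = xList F ((List.finRange m).map fun j => (σ j : ℕ)) := by
  simp [gX, wd, Function.comp_def]

theorem lift_list (m : ℕ) (l : List ℕ) (h : ∀ x ∈ l, x < m) :
    ∃ l' : List (Fin m), l'.map Fin.val = l := by
  induction l with
  | nil => exact ⟨[], rfl⟩
  | cons a t ih =>
    obtain ⟨t', rfl⟩ := ih fun x hx => h x (List.mem_cons_of_mem _ hx)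
    exact ⟨⟨a, h a (by simp)⟩ :: t', rfl⟩

theorem map_val_words {m n : ℕ} (u v : List (Fin m)) (ws : Fin n → List (Fin m)) :
    (u ++ (List.ofFn ws).flatten ++ v).map Fin.val =
      u.map Fin.val ++ (List.ofFn (fun i => (ws i).map Fin.val)).flatten ++ v.map Fin.val := by
  rw [List.map_append, List.map_append, List.map_flatten, List.map_ofFn]
  rfl

theorem gX_mem_Vm (F : Type) [Field F] (m : ℕ) (l : List (Fin m)) (h : l.Perm (List.finRange m)) :
    gX F m l ∈ Vm F m := by
  obtain ⟨σ, rfl⟩ := exists_wd l h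
  rw [gX_wd]
  exact Submodule.subset_span ⟨σ, rfl⟩

theorem W_eq (F : Type) [Field F] [CharZero F] (n K m : ℕ) (hn : 1 ≤ n) (hm : m = n + K) :
    Wnm F n m = Submodule.span F
      (Set.range fun f : Fin K ⊕ Fin K → Fin (m + 1) => rowS (gX F m) f) := by
  classical
  apply le_antisymm
  · rintro x ⟨hxV, hxT⟩
    set Q := liftB F (fun l => if l.Perm (List.range m) then xList F l else 0) with hQ
    have hJ : iB F x ∈ JB F n := TGen_le F n hn hxT
    have h1 : Q (iB F x) = x := by
      have : Set.EqOn (Q ∘ₗ (iB F : FreeNA F →ₗ[F] FreeB F)) (LinearMap.id : FreeNA F →ₗ[F] FreeNA F)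
          (Submodule.span F (Set.range fun σ : Equiv.Perm (Fin m) =>
            xList F ((List.finRange m).map fun j => (σ j : ℕ)))) := by
        apply LinearMap.eqOn_span
        rintro _ ⟨σ, rfl⟩
        change Q (iB F _) = xList F _
        have hperm : ((List.finRange m).map fun j => (σ j : ℕ)).Perm (List.range m) := by
          have := (Equiv.Perm.map_finRange_perm σ).map Fin.val
          rw [List.map_map, List.map_coe_finRange_eq_range] at this
          exact this
        rw [iB_x, hQ, liftB_bW, if_pos hperm]
        intro h
        have := congrArg List.length h
        simp at this
        omega
      exact this hxV
    rw [← h1]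
    generalize iB F x = y at hJ
    unfold JB at hJ
    induction hJ using Submodule.span_induction with
    | mem y hy =>
      obtain ⟨u, v, ws, h, rfl⟩ := hy
      rw [gen_eq, map_sum, hQ]
      simp only [liftB_bW]
      have hpp : ∀ τ : Equiv.Perm (Fin n),
          (u ++ (List.ofFn (fun i => ws (τ i))).flatten ++ v).Perm
            (u ++ (List.ofFn ws).flatten ++ v) := fun τ =>
        ((flatten_perm ws τ).append_left u).append_right v
      by_cases hc : (u ++ (List.ofFn ws).flatten ++ v).Perm (List.range m)
      · have hlt : ∀ x ∈ (u ++ (List.ofFn ws).flatten ++ v), x < m := fun x hx =>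
          List.mem_range.1 (hc.mem_iff.1 hx)
        obtain ⟨u', rfl⟩ := lift_list m u fun x hx => hlt x (by simp [hx])
        obtain ⟨v', rfl⟩ := lift_list m v fun x hx => hlt x (by simp [hx])
        have hw : ∀ i, ∃ l' : List (Fin m), l'.map Fin.val = ws i := fun i =>
          lift_list m (ws i) fun x hx => hlt x (by
            have := (block_infix ws i).subset hx
            exact List.mem_append_left _ (List.mem_append_right _ this))
        choose ws' hws using hw
        obtain rfl : (fun i => (ws' i).map Fin.val) = ws := funext hws
        have hdec : IsDec u' ws' v' := by
          refine ⟨fun i h0 => h i (by simp [h0]), ?_⟩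
          rw [← List.map_perm_map_iff Fin.val_injective, map_val_words,
            List.map_coe_finRange_eq_range]
          exact hc
        obtain ⟨f, hf⟩ := gen_is_row n K m hn hm u' v' ws' hdec (gX F m)
        refine Submodule.subset_span ⟨f, ?_⟩
        refine hf.symm.trans ?_
        refine Finset.sum_congr rfl fun τ _ => ?_
        rw [if_pos ((hpp τ).trans hc), gX, map_val_words u' v' (fun i => ws' (τ i))]
      · rw [Finset.sum_eq_zero]
        · exact zero_mem _
        · intro τ _
          exact if_neg fun h => hc ((hpp τ).symm.trans h)
    | zero => simp
    | add x y _ _ h1 h2 => rw [map_add]; exact add_mem h1 h2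
    | smul c x _ h => rw [map_smul]; exact Submodule.smul_mem _ _ h
  · rw [Submodule.span_le]
    rintro _ ⟨f, rfl⟩
    rcases row_is_gen n K m hn hm (gX F m) f with h | ⟨u, v, ws, hdec, h⟩
    · simp only [h]; exact zero_mem _
    · simp only [h]
      refine ⟨Submodule.sum_mem _ fun τ _ => gX_mem_Vm F m _ ?_, ?_⟩
      · exact (((flatten_perm ws τ).append_left u).append_right v).trans hdec.2
      · have := gen_mem_T F n hn (u.map Fin.val) (v.map Fin.val) (fun i => (ws i).map Fin.val)
          (fun i h0 => hdec.1 i (by simpa using h0))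
        have he : ∀ τ : Equiv.Perm (Fin n), gX F m (u ++ (List.ofFn fun i => ws (τ i)).flatten ++ v) =
          xList F (u.map Fin.val ++ (List.ofFn (fun i => (ws (τ i)).map Fin.val)).flatten ++
            v.map Fin.val) := fun τ => by rw [gX, map_val_words u v (fun i => ws (τ i))]
        simp only [he]
        exact this

theorem xList_inj (F : Type) [Field F] (l l' : List ℕ) (hl : l ≠ []) (hl' : l' ≠ [])
    (h : xList F l = xList F l') : l = l' := by
  rcases l with _ | ⟨a, t⟩
  · exact absurd rfl hl
  rcases l' with _ | ⟨b, s⟩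
  · exact absurd rfl hl'
  rw [← basis_x, ← basis_x] at h
  have := (MonoidAlgebra.basis (FreeSemigroup ℕ) F).injective h
  injection this with h1 h2
  rw [h1, h2]

theorem words_li (F : Type) [Field F] (m : ℕ) (hm : 1 ≤ m) :
    LinearIndependent F (fun σ : Equiv.Perm (Fin m) => gX F m (wd σ)) := by
  have hne : ∀ σ : Equiv.Perm (Fin m), (wd σ).map Fin.val ≠ [] := by
    intro σ h
    have := congrArg List.length h
    simp [wd] at this
    omega
  have h1 : ∀ σ : Equiv.Perm (Fin m), ∃ w : FreeSemigroup ℕ,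
      MonoidAlgebra.basis (FreeSemigroup ℕ) F w = gX F m (wd σ) := by
    intro σ
    unfold gX
    have := hne σ
    generalize (wd σ).map Fin.val = l at this
    rcases l with _ | ⟨a, t⟩
    · exact absurd rfl this
    · exact ⟨⟨a, t⟩, rfl⟩
  choose s hs using h1
  have hinj : Function.Injective s := by
    intro σ τ h
    have h2 : gX F m (wd σ) = gX F m (wd τ) := by rw [← hs, ← hs, h]
    have h3 := xList_inj F _ _ (hne σ) (hne τ) h2
    have h4 := List.map_injective_iff.2 Fin.val_injective h3
    simp only [wd] at h4
    ext i
    have := List.map_inj_left.1 h4 i (List.mem_finRange i)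
    rw [this]
  have := (MonoidAlgebra.basis (FreeSemigroup ℕ) F).linearIndependent.comp s hinj
  convert this using 1
  funext σ
  exact (hs σ).symm

theorem finrank_W (F : Type) [Field F] [CharZero F] (n K m : ℕ) (hn : 1 ≤ n) (hm : m = n + K) :
    Module.finrank F (Wnm F n m) = ((Amat K (m + 1)).map (algebraMap ℚ F)).rank := by
  classical
  set Φ : (Equiv.Perm (Fin m) → F) →ₗ[F] FreeNA F :=
    Fintype.linearCombination F (fun σ : Equiv.Perm (Fin m) => gX F m (wd σ)) with hΦ
  have hinj : Function.Injective Φ :=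
    LinearIndependent.fintypeLinearCombination_injective (words_li F m (by omega))
  have hrow : ∀ f : Fin K ⊕ Fin K → Fin (m + 1),
      Φ (fun σ => algebraMap ℚ F (Amat K (m + 1) f σ)) = rowS (gX F m) f := by
    intro f
    rw [hΦ, Fintype.linearCombination_apply]
    unfold rowS
    refine Finset.sum_congr rfl fun σ _ => ?_
    change algebraMap ℚ F (if (arrows f).Nodup ∧ ∀ p ∈ arrows f, cyc σ p.1 = p.2 then 1 else 0) •
      gX F m (wd σ) = _
    split_ifs <;> simp
  rw [Matrix.rank_eq_finrank_span_row]
  have : Wnm F n m = (Submodule.span F (Set.range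
      ((Amat K (m + 1)).map (algebraMap ℚ F)).row)).map Φ := by
    rw [W_eq F n K m hn hm, Submodule.map_span, ← Set.range_comp]
    congr 2
    funext f
    exact (hrow f).symm
  rw [this]
  exact (LinearEquiv.finrank_eq (Submodule.equivMapOfInjective Φ hinj _)).symm

/-- For fixed `K`, `dim W_{n,n+K}` is eventually given by a polynomial in `n`. -/
theorem dim_W_eventually_polynomial (F : Type) [Field F] [CharZero F] (K : ℕ) :
    ∃ N : ℕ, 0 < N ∧ ∃ p : Polynomial ℚ, ∀ n : ℕ, N ≤ n →
      (Module.finrank F (Wnm F n (n + K)) : ℚ) = Polynomial.eval (n : ℚ) p := by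
  obtain ⟨p, M1, hp⟩ := Amat_rank K F
  refine ⟨M1 + 1, Nat.succ_pos _,
    p.comp (Polynomial.X + Polynomial.C ((K + 1 : ℕ) : ℚ)), fun n hn => ?_⟩
  rw [finrank_W F n K (n + K) (by omega) rfl, hp (n + K + 1) (by omega), Polynomial.eval_comp]
  congr 1
  simp only [Polynomial.eval_add, Polynomial.eval_X, Polynomial.eval_C]
  push_cast
  ring

end
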